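/- arXiv:2411.12399 — 2 statements merged into one kernel-verified Lean document; each statement's English description precedes it below -/
import Mathlib

section
/- Let 1 ≤ p < 2, T ∈ M_{2^n} with 0 ≤ T ≤ 1, d₀ = 4 Inf^p(T)/var(T), and define 𝔻_≥ = {d ∈ {2^k} : W_{≈d}(T) ≥ var(T)²/(16 Inf^p(T))}, where W_{≈d}(T) = Σ_{d ≤ |supp(s)| < 2d}|T̂(s)|² and Inf^p(T) = Σ_j ‖d_j(T)‖_p^p. Then Σ_{d ∈ 𝔻_≥} W_{≈d}(T) ≥ (1/2) var(T). -/
open scoped BigOperators ComplexOrder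
open Matrix

noncomputable section

abbrev QM (n : ℕ) := Matrix (Fin n → Fin 2) (Fin n → Fin 2) ℂ

namespace QM

variable {n : ℕ}

/-- Normalized trace on `M_{2^n}`. -/
def qtr (T : QM n) : ℂ := Matrix.trace T / 2 ^ n

/-- Singular values of `T` (eigenvalues of `|T| = (TᴴT)^{1/2}`). -/
def sv (T : QM n) (i : Fin n → Fin 2) : ℝ :=
  Real.sqrt ((Matrix.posSemidef_conjTranspose_mul_self T).1.eigenvalues i)

/-- Normalized Schatten `p`-norm: `(tr |T|^p)^{1/p}` with normalized trace. -/
def snorm (p : ℝ) (T : QM n) : ℝ :=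
  ((∑ i, sv T i ^ p) / 2 ^ n) ^ (1 / p)

/-- Squared normalized `L₂`-norm: `tr(TᴴT)`. -/
def l2sq (T : QM n) : ℝ := (Matrix.trace (Tᴴ * T)).re / 2 ^ n

/-- Variance `‖T - tr(T)1‖₂²`. -/
def qvar (T : QM n) : ℝ := l2sq (T - qtr T • 1)

/-- Operator norm. -/
def opnorm (T : QM n) : ℝ := ‖Matrix.toEuclideanCLM (𝕜 := ℂ) T‖

/-- The Pauli matrices. -/
def pauli : Fin 4 → Matrix (Fin 2) (Fin 2) ℂ
  | 0 => 1
  | 1 => !![1, 0; 0, -1]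
  | 2 => !![0, 1; 1, 0]
  | 3 => !![0, Complex.I; -Complex.I, 0]

/-- The Pauli tensor basis `σ_s` for `s ∈ {0,1,2,3}^n`. -/
def sigma (s : Fin n → Fin 4) : QM n :=
  Matrix.of fun x y => ∏ j, pauli (s j) (x j) (y j)

/-- Fourier coefficient `T̂(s) = tr(σ_s* T)`. -/
def fc (T : QM n) (s : Fin n → Fin 4) : ℂ := qtr ((sigma s)ᴴ * T)

/-- Support of a multi-index. -/
def supp (s : Fin n → Fin 4) : Finset (Fin n) := Finset.univ.filter fun j => s j ≠ 0

/-- The `k`-th partial derivative, via the Fourier expansion. -/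
def djF (k : Fin n) (T : QM n) : QM n :=
  ∑ s ∈ Finset.univ.filter (fun s : Fin n → Fin 4 => s k ≠ 0), fc T s • sigma s

/-- Conditional expectation onto the subalgebra `M_J`. -/
def condExp (J : Finset (Fin n)) (T : QM n) : QM n :=
  ∑ s ∈ Finset.univ.filter (fun s : Fin n → Fin 4 => supp s ⊆ J), fc T s • sigma s

/-- The restriction operator `R_j^J(T) = 𝓔_{M_{J^c ∪ {j}}}(d_j(T))`. -/
def RR (J : Finset (Fin n)) (j : Fin n) (T : QM n) : QM n :=
  condExp (Jᶜ ∪ {j}) (djF j T)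

/-- The operator `δ^𝓛`. -/
def deltaL (δ : ℝ) (T : QM n) : QM n :=
  ∑ s : Fin n → Fin 4, (((δ : ℂ) ^ (supp s).card) * fc T s) • sigma s

/-- The quantum Ornstein–Uhlenbeck semigroup `e^{-t𝓛}`. -/
def heat (t : ℝ) (T : QM n) : QM n :=
  ∑ s : Fin n → Fin 4, ((Real.exp (-t * (supp s).card) : ℂ) * fc T s) • sigma s

/-- `H_d(T) = (1-1/(2d))^𝓛(T) - (1-1/d)^𝓛(T)`. -/
def Hd (d : ℕ) (T : QM n) : QM n :=
  deltaL (1 - 1 / (2 * (d : ℝ))) T - deltaL (1 - 1 / (d : ℝ)) T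

/-- Probability of a subset `J` when each coordinate is included with probability `δ`. -/
def mu (δ : ℝ) (J : Finset (Fin n)) : ℝ := δ ^ J.card * (1 - δ) ^ (n - J.card)

/-- Total `L₂`-influence via Fourier coefficients. -/
def InfF (T : QM n) : ℝ := ∑ s : Fin n → Fin 4, ((supp s).card : ℝ) * ‖fc T s‖ ^ 2

/-- Spectral weight `W_{≈d}(T)`. -/
def Wapprox (T : QM n) (d : ℕ) : ℝ :=
  ∑ s ∈ Finset.univ.filter
      (fun s : Fin n → Fin 4 => d ≤ (supp s).card ∧ (supp s).card < 2 * d),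
    ‖fc T s‖ ^ 2

/-- Conditional expectation onto the algebra with identity in slot `j`
(`id ⊗ ⋯ ⊗ tr(·)1₂ ⊗ ⋯ ⊗ id`). -/
def slotExp (j : Fin n) (T : QM n) : QM n :=
  Matrix.of fun x y =>
    if x j = y j then (∑ b : Fin 2, T (Function.update x j b) (Function.update y j b)) / 2
    else 0

/-- The `j`-th partial derivative `d_j = id - (id ⊗ ⋯ ⊗ tr(·)1₂ ⊗ ⋯ ⊗ id)`. -/
def dj (j : Fin n) (T : QM n) : QM n := T - slotExp j T

end QM

namespace DM
open QM

variable {n : ℕ}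

def tens (M : Fin n → Matrix (Fin 2) (Fin 2) ℂ) : QM n :=
  Matrix.of fun x y => ∏ j, M j (x j) (y j)

lemma sigma_eq (s : Fin n → Fin 4) : sigma s = tens fun j => pauli (s j) := rfl

lemma tens_mul (M N : Fin n → Matrix (Fin 2) (Fin 2) ℂ) :
    tens M * tens N = tens fun j => M j * N j := by
  ext x y
  simp only [Matrix.mul_apply, tens, Matrix.of_apply, ← Finset.prod_mul_distrib]
  rw [Finset.prod_univ_sum]
  simp

lemma tens_conj (M : Fin n → Matrix (Fin 2) (Fin 2) ℂ) :
    (tens M)ᴴ = tens fun j => (M j)ᴴ := by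
  ext x y
  simp [tens, Matrix.conjTranspose_apply]

lemma tens_one : tens (fun _ : Fin n => (1 : Matrix (Fin 2) (Fin 2) ℂ)) = 1 := by
  ext x y
  simp only [tens, Matrix.of_apply, Matrix.one_apply]
  by_cases h : x = y
  · subst h; simp
  · rw [if_neg h]
    obtain ⟨j, hj⟩ := Function.ne_iff.mp h
    exact Finset.prod_eq_zero (Finset.mem_univ j) (if_neg hj)

lemma tens_trace (M : Fin n → Matrix (Fin 2) (Fin 2) ℂ) :
    (tens M).trace = ∏ j, (M j).trace := by
  simp only [Matrix.trace, Matrix.diag, tens, Matrix.of_apply]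
  rw [Finset.prod_univ_sum]
  simp

lemma pauli_orth (a b : Fin 4) :
    ((pauli a)ᴴ * pauli b).trace = if a = b then 2 else 0 := by
  fin_cases a <;> fin_cases b <;>
    simp [pauli, Matrix.trace, Matrix.mul_apply, Fin.sum_univ_two, Matrix.conjTranspose_apply,
      Matrix.one_apply] <;> norm_num

lemma pauli_complete (x y x' y' : Fin 2) :
    ∑ a, star (pauli a x y) * pauli a x' y' = if x = x' ∧ y = y' then 2 else 0 := by
  fin_cases x <;> fin_cases y <;> fin_cases x' <;> fin_cases y' <;>
    simp [pauli, Fin.sum_univ_four, Matrix.one_apply] <;> norm_num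

lemma pauli_unit (a : Fin 4) : pauli a * (pauli a)ᴴ = 1 := by
  ext x y
  fin_cases a <;> fin_cases x <;> fin_cases y <;>
    simp [pauli, Matrix.mul_apply, Fin.sum_univ_two, Matrix.conjTranspose_apply]

lemma pauli_twirl (b : Fin 4) (x y : Fin 2) :
    ∑ a, (pauli a * pauli b * (pauli a)ᴴ) x y = if b = 0 then 4 * pauli b x y else 0 := by
  fin_cases b <;> fin_cases x <;> fin_cases y <;>
    simp [pauli, Matrix.mul_apply, Fin.sum_univ_two, Fin.sum_univ_four,
      Matrix.conjTranspose_apply, Matrix.one_apply] <;> norm_num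

lemma fc_sigma (s t : Fin n → Fin 4) : fc (sigma t) s = if s = t then 1 else 0 := by
  unfold fc qtr
  rw [sigma_eq, sigma_eq, tens_conj, tens_mul, tens_trace]
  simp only [pauli_orth]
  by_cases h : s = t
  · subst h; simp
  · rw [if_neg h]
    obtain ⟨j, hj⟩ := Function.ne_iff.mp h
    rw [Finset.prod_eq_zero (Finset.mem_univ j) (if_neg hj)]; simp

lemma fc_sum {ι : Type*} (S : Finset ι) (c : ι → ℂ) (f : ι → QM n) (s : Fin n → Fin 4) :
    fc (∑ i ∈ S, c i • f i) s = ∑ i ∈ S, c i * fc (f i) s := by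
  simp only [fc, qtr, Finset.mul_sum, Matrix.trace_sum, Matrix.mul_smul, Matrix.trace_smul,
    smul_eq_mul, Finset.sum_div, mul_div_assoc]

lemma sigma_complete (x y x' y' : Fin n → Fin 2) :
    ∑ s : Fin n → Fin 4, star (sigma s x y) * sigma s x' y'
      = if x = x' ∧ y = y' then 2 ^ n else 0 := by
  have : ∀ s : Fin n → Fin 4, star (sigma s x y) * sigma s x' y'
      = ∏ j, star (pauli (s j) (x j) (y j)) * pauli (s j) (x' j) (y' j) := by
    intro s
    simp [sigma, Finset.prod_mul_distrib]
  simp only [this]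
  have h2 := Finset.prod_univ_sum (fun _ : Fin n => (Finset.univ : Finset (Fin 4)))
    (fun j a => star (pauli a (x j) (y j)) * pauli a (x' j) (y' j))
  simp only [Fintype.piFinset_univ] at h2
  rw [← h2]
  simp only [pauli_complete]
  by_cases h : x = x' ∧ y = y'
  · obtain ⟨rfl, rfl⟩ := h; simp
  · rw [if_neg h]
    have : ∃ j, ¬ (x j = x' j ∧ y j = y' j) := by
      by_contra hc
      push Not at hc
      exact h ⟨funext fun j => (hc j).1, funext fun j => (hc j).2⟩
    obtain ⟨j, hj⟩ := this
    exact Finset.prod_eq_zero (Finset.mem_univ j) (if_neg hj)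

lemma inversion (T : QM n) : ∑ s, fc T s • sigma s = T := by
  ext x' y'
  simp only [Matrix.sum_apply, Matrix.smul_apply, smul_eq_mul, fc, qtr, Matrix.trace, Matrix.diag,
    Matrix.mul_apply, Matrix.conjTranspose_apply]
  have : ∀ s : Fin n → Fin 4,
      (∑ y, ∑ x, star (sigma s x y) * T x y) / 2 ^ n * sigma s x' y'
      = ∑ y, ∑ x, (star (sigma s x y) * sigma s x' y') * (T x y / 2 ^ n) := by
    intro s
    rw [Finset.sum_div, Finset.sum_mul]
    refine Finset.sum_congr rfl fun y _ => ?_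
    rw [Finset.sum_div, Finset.sum_mul]
    refine Finset.sum_congr rfl fun x _ => ?_
    ring
  simp only [this]
  rw [Finset.sum_comm]
  rw [Finset.sum_eq_single y']
  · rw [Finset.sum_comm, Finset.sum_eq_single x']
    · rw [← Finset.sum_mul, sigma_complete, if_pos ⟨rfl, rfl⟩]
      exact mul_div_cancel₀ _ (pow_ne_zero _ two_ne_zero)
    · intro x _ hx
      rw [← Finset.sum_mul, sigma_complete]
      simp [hx]
    · simp
  · intro y _ hy
    rw [Finset.sum_comm]
    refine Finset.sum_eq_zero fun x _ => ?_
    rw [← Finset.sum_mul, sigma_complete]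
    simp [hy]
  · simp

lemma parseval (T : QM n) : l2sq T = ∑ s, ‖fc T s‖ ^ 2 := by
  have h : (Tᴴ * T).trace / 2 ^ n = ∑ s, ((‖fc T s‖ ^ 2 : ℝ) : ℂ) := by
    conv_lhs => rw [← inversion T]
    conv_lhs => enter [1, 1, 1]; rw [inversion T]
    rw [Finset.mul_sum, Matrix.trace_sum, Finset.sum_div]
    refine Finset.sum_congr rfl fun s _ => ?_
    rw [Matrix.mul_smul, Matrix.trace_smul, smul_eq_mul, mul_div_assoc]
    have : (Tᴴ * sigma s).trace / 2 ^ n = star (fc T s) := by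
      unfold fc qtr
      rw [star_div₀, ← Matrix.trace_conjTranspose]
      simp
    rw [this]
    push_cast
    exact Complex.mul_conj' _
  unfold l2sq
  have h' := congrArg Complex.re h
  rw [← Complex.ofReal_sum, Complex.ofReal_re] at h'
  rw [← h']
  have : (2 ^ n : ℂ) = ((2 ^ n : ℝ) : ℂ) := by push_cast; rfl
  rw [this, Complex.div_ofReal_re]

lemma fc_djF (k : Fin n) (T : QM n) (s : Fin n → Fin 4) :
    fc (djF k T) s = if s k ≠ 0 then fc T s else 0 := by
  unfold djF
  rw [fc_sum]
  simp only [fc_sigma, mul_ite, mul_one, mul_zero, Finset.sum_ite_eq, Finset.mem_filter,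
    Finset.mem_univ, true_and]

lemma sigma_zero : sigma (0 : Fin n → Fin 4) = 1 := by
  rw [sigma_eq, ← tens_one]; rfl

lemma qvar_eq (T : QM n) : qvar T = ∑ s, if s ≠ 0 then ‖fc T s‖ ^ 2 else 0 := by
  unfold qvar
  rw [parseval]
  refine Finset.sum_congr rfl fun s _ => ?_
  have h1 : fc (T - qtr T • 1) s = fc T s - qtr T * fc 1 s := by
    simp only [fc, qtr, Matrix.mul_sub, Matrix.trace_sub, Matrix.mul_smul, Matrix.trace_smul,
      smul_eq_mul]
    ring
  have h2 : fc T 0 = qtr T := by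
    unfold fc; rw [sigma_zero]; simp
  rw [h1, ← sigma_zero, fc_sigma]
  by_cases h : s = 0
  · subst h; simp [h2]
  · simp [h]

/-- slot Pauli -/
def A (j : Fin n) (a : Fin 4) : QM n := tens (Function.update (fun _ => 1) j (pauli a))

lemma A_unit (j : Fin n) (a : Fin 4) : A j a * (A j a)ᴴ = 1 := by
  unfold A
  rw [tens_conj, tens_mul, ← tens_one]
  congr 1
  ext1 i
  by_cases h : i = j
  · subst h; simp [pauli_unit]
  · simp [h]

lemma A_twirl (j : Fin n) (s : Fin n → Fin 4) :
    ∑ a, A j a * sigma s * (A j a)ᴴ = if s j = 0 then (4 : ℂ) • sigma s else 0 := by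
  have h : ∀ a (x y : Fin n → Fin 2), (A j a * sigma s * (A j a)ᴴ) x y
      = (pauli a * pauli (s j) * (pauli a)ᴴ) (x j) (y j) *
        ∏ i ∈ Finset.univ.erase j, pauli (s i) (x i) (y i) := by
    intro a x y
    unfold A
    rw [sigma_eq, tens_conj, tens_mul, tens_mul]
    simp only [tens, Matrix.of_apply]
    rw [← Finset.mul_prod_erase _ _ (Finset.mem_univ j)]
    congr 1
    · simp
    · refine Finset.prod_congr rfl fun i hi => ?_
      have : i ≠ j := Finset.ne_of_mem_erase hi
      simp [this]
  ext x y
  rw [Matrix.sum_apply]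
  simp only [h]
  rw [← Finset.sum_mul, pauli_twirl]
  by_cases hs : s j = 0
  · simp only [hs, if_true, Matrix.smul_apply, smul_eq_mul, sigma, Matrix.of_apply]
    rw [← Finset.mul_prod_erase Finset.univ _ (Finset.mem_univ j), hs]
    ring
  · simp [hs]

def E (j : Fin n) (T : QM n) : QM n := (1 / 4 : ℂ) • ∑ a, A j a * T * (A j a)ᴴ

lemma E_psd (j : Fin n) {T : QM n} (h : T.PosSemidef) : (E j T).PosSemidef := by
  unfold E
  refine Matrix.PosSemidef.smul ?_ (by rw [Complex.le_def]; norm_num)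
  exact Matrix.posSemidef_sum _ fun a _ => h.mul_mul_conjTranspose_same _

lemma E_sub (j : Fin n) (T : QM n) : E j (1 - T) = 1 - E j T := by
  unfold E
  simp only [Matrix.mul_sub, Matrix.sub_mul, Matrix.mul_one, A_unit, Finset.sum_sub_distrib,
    smul_sub, Finset.sum_const, Finset.card_univ, Fintype.card_fin]
  congr 1
  rw [← Nat.cast_smul_eq_nsmul ℂ, smul_smul]
  norm_num

lemma djF_eq (j : Fin n) (T : QM n) : djF j T = T - E j T := by
  have hE : E j T = ∑ s, if s j = 0 then fc T s • sigma s else 0 := by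
    conv_lhs => rw [← inversion T]
    unfold E
    simp only [Finset.mul_sum, Finset.sum_mul]
    rw [Finset.sum_comm, Finset.smul_sum]
    refine Finset.sum_congr rfl fun s _ => ?_
    simp only [Matrix.mul_smul, Matrix.smul_mul]
    rw [← Finset.smul_sum, A_twirl]
    split_ifs
    · rw [smul_smul, smul_smul]; congr 1; ring
    · simp
  rw [hE]
  conv_rhs => enter [1]; rw [← inversion T]
  rw [← Finset.sum_sub_distrib]
  unfold djF
  rw [Finset.sum_filter]
  refine Finset.sum_congr rfl fun s _ => ?_
  by_cases h : s j = 0 <;> simp [h]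

lemma djF_contr (j : Fin n) {T : QM n} (h0 : T.PosSemidef) (h1 : ((1 : QM n) - T).PosSemidef) :
    (1 - (djF j T)ᴴ * djF j T).PosSemidef := by
  set D := djF j T with hD
  have hE0 := E_psd j h0
  have hE1 := E_psd j h1
  rw [E_sub] at hE1
  have hDe := djF_eq j T
  have hm : (1 - D).PosSemidef := by
    have := h1.add hE0
    convert this using 1
    rw [hD, hDe]; abel
  have hp : (1 + D).PosSemidef := by
    have := h0.add hE1
    convert this using 1
    rw [hD, hDe]; abel
  have hH : Dᴴ = D := by
    rw [hD, hDe, Matrix.conjTranspose_sub, h0.1.eq, hE0.1.eq]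
  rw [hH]
  have e1 := hp.mul_mul_conjTranspose_same (1 - D)
  have e2 := hm.mul_mul_conjTranspose_same (1 + D)
  rw [hm.1.eq] at e1
  rw [hp.1.eq] at e2
  have e3 := (e1.add e2).smul (show (0 : ℂ) ≤ 1 / 2 by rw [Complex.le_def]; norm_num)
  convert e3 using 1
  have : (1 - D) * (1 + D) * (1 - D) + (1 + D) * (1 - D) * (1 + D) = (2 : ℂ) • (1 - D * D) := by
    rw [two_smul]; noncomm_ring
  rw [this, smul_smul]; norm_num

lemma eig_le {D : QM n} (h : (1 - Dᴴ * D).PosSemidef) (i : Fin n → Fin 2) :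
    (Matrix.posSemidef_conjTranspose_mul_self D).1.eigenvalues i ≤ 1 := by
  set hA := (Matrix.posSemidef_conjTranspose_mul_self D).1
  have h2 := h.re_dotProduct_nonneg (hA.eigenvectorBasis i)
  rw [Matrix.sub_mulVec, Matrix.one_mulVec, dotProduct_sub, map_sub, hA.mulVec_eigenvectorBasis,
    dotProduct_smul] at h2
  have h3 : star (hA.eigenvectorBasis i : (Fin n → Fin 2) → ℂ) ⬝ᵥ
      (hA.eigenvectorBasis i : (Fin n → Fin 2) → ℂ) = 1 := by
    have := hA.eigenvectorBasis.orthonormal.1 i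
    have h4 := inner_self_eq_norm_sq_to_K (𝕜 := ℂ) (hA.eigenvectorBasis i)
    rw [this, EuclideanSpace.inner_eq_star_dotProduct, dotProduct_comm] at h4
    simpa using h4
  rw [h3] at h2
  simpa using h2

lemma snorm_ge {D : QM n} (h : (1 - Dᴴ * D).PosSemidef) {p : ℝ} (hp1 : 1 ≤ p) (hp2 : p < 2) :
    l2sq D ≤ snorm p D ^ p := by
  have hsv0 : ∀ i, 0 ≤ sv D i := fun i => Real.sqrt_nonneg _
  unfold snorm
  rw [← Real.rpow_mul (by
    have : ∀ i, 0 ≤ sv D i ^ p := fun i => Real.rpow_nonneg (hsv0 i) _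
    have := Finset.sum_nonneg fun i (_ : i ∈ Finset.univ) => this i
    positivity), one_div_mul_cancel (by linarith), Real.rpow_one]
  unfold l2sq
  gcongr
  set hP := Matrix.posSemidef_conjTranspose_mul_self D
  rw [hP.1.trace_eq_sum_eigenvalues, Complex.re_sum]
  refine Finset.sum_le_sum fun i _ => ?_
  have h1 : sv D i ≤ 1 := Real.sqrt_le_one.mpr (eig_le h i)
  have h2 : sv D i ^ (2 : ℝ) ≤ sv D i ^ p :=
    Real.rpow_le_rpow_of_exponent_ge_of_imp (hsv0 i) h1 hp2.le (by intro _ h; linarith)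
  refine le_trans (le_of_eq ?_) h2
  rw [Real.rpow_two]
  unfold sv
  rw [Real.sq_sqrt (hP.eigenvalues_nonneg i)]
  rfl

lemma InfF_le {p : ℝ} (hp1 : 1 ≤ p) (hp2 : p < 2) {T : QM n}
    (h0 : T.PosSemidef) (h1 : ((1 : QM n) - T).PosSemidef) :
    InfF T ≤ ∑ j, snorm p (djF j T) ^ p := by
  have : InfF T = ∑ j, l2sq (djF j T) := by
    simp only [parseval, fc_djF]
    rw [Finset.sum_comm]
    unfold InfF
    refine Finset.sum_congr rfl fun s _ => ?_
    rw [supp, Finset.card_filter]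
    push_cast
    rw [Finset.sum_mul]
    refine Finset.sum_congr rfl fun j _ => ?_
    by_cases h : s j = 0 <;> simp [h]
  rw [this]
  exact Finset.sum_le_sum fun j _ => snorm_ge (djF_contr j h0 h1) hp1 hp2

lemma level_iff (c k : ℕ) : (2 ^ k ≤ c ∧ c < 2 * 2 ^ k) ↔ c ≠ 0 ∧ k = Nat.log 2 c := by
  constructor
  · rintro ⟨h1, h2⟩
    have hc : c ≠ 0 := by have := Nat.two_pow_pos k; omega
    refine ⟨hc, ?_⟩
    symm
    rw [Nat.log_eq_iff (Or.inr ⟨by norm_num, hc⟩)]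
    exact ⟨h1, by rw [pow_succ]; omega⟩
  · rintro ⟨hc, rfl⟩
    refine ⟨Nat.pow_log_le_self 2 hc, ?_⟩
    have := Nat.lt_pow_succ_log_self (b := 2) (by norm_num) c
    rw [pow_succ] at this; omega

lemma W_eq (T : QM n) (k : ℕ) : Wapprox T (2 ^ k) =
    ∑ s, if (supp s).card ≠ 0 ∧ k = Nat.log 2 (supp s).card then ‖fc T s‖ ^ 2 else 0 := by
  unfold Wapprox
  rw [Finset.sum_filter]
  simp only [level_iff]

lemma card_le (s : Fin n → Fin 4) : (supp s).card ≤ n := by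
  simpa using Finset.card_le_univ (supp s)

lemma log_lt (s : Fin n → Fin 4) : Nat.log 2 (supp s).card < n + 1 :=
  lt_of_le_of_lt (Nat.log_le_self _ _) (Nat.lt_succ_of_le (card_le s))

lemma W_nonneg (T : QM n) (d : ℕ) : 0 ≤ Wapprox T d :=
  Finset.sum_nonneg fun _ _ => by positivity

lemma W_zero (T : QM n) {k : ℕ} (hk : n + 1 ≤ k) : Wapprox T (2 ^ k) = 0 := by
  rw [W_eq]
  refine Finset.sum_eq_zero fun s _ => if_neg ?_
  rintro ⟨_, h⟩
  have := log_lt s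
  omega

lemma sum_W (T : QM n) (g : ℕ → ℝ) : ∑ k ∈ Finset.range (n + 1), g k * Wapprox T (2 ^ k) =
    ∑ s, if (supp s).card ≠ 0 then g (Nat.log 2 (supp s).card) * ‖fc T s‖ ^ 2 else 0 := by
  simp only [W_eq, Finset.mul_sum]
  rw [Finset.sum_comm]
  refine Finset.sum_congr rfl fun s _ => ?_
  by_cases h : (supp s).card ≠ 0
  · simp only [h, ne_eq, not_false_eq_true, true_and, mul_ite, mul_zero, if_true]
    rw [Finset.sum_ite_eq', if_pos (Finset.mem_range.mpr (log_lt s))]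
  · simp [h]

lemma var_eq_sum (T : QM n) : qvar T = ∑ k ∈ Finset.range (n + 1), Wapprox T (2 ^ k) := by
  have := sum_W T (fun _ => 1)
  simp only [one_mul] at this
  rw [this, qvar_eq]
  refine Finset.sum_congr rfl fun s _ => ?_
  have : s ≠ 0 ↔ (supp s).card ≠ 0 := by
    rw [not_iff_not, Finset.card_eq_zero, supp, Finset.filter_eq_empty_iff, funext_iff]
    simp
  simp only [this]

lemma sum_le_Inf (T : QM n) :
    ∑ k ∈ Finset.range (n + 1), (2 : ℝ) ^ k * Wapprox T (2 ^ k) ≤ InfF T := by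
  rw [sum_W]
  unfold InfF
  refine Finset.sum_le_sum fun s _ => ?_
  split_ifs with h
  · gcongr
    exact_mod_cast Nat.pow_log_le_self 2 h
  · positivity

lemma abstract_mass (N : ℕ) (W : ℕ → ℝ) (hW : ∀ k, 0 ≤ W k) (V I : ℝ)
    (hV : V = ∑ k ∈ Finset.range N, W k)
    (hI : ∑ k ∈ Finset.range N, (2 : ℝ) ^ k * W k ≤ I) :
    ∑ k ∈ (Finset.range N).filter (fun k => ¬ V ^ 2 / (16 * I) ≤ W k), W k ≤ V / 2 := by
  have hV0 : 0 ≤ V := hV ▸ Finset.sum_nonneg fun k _ => hW k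
  rcases hV0.eq_or_lt with h | hVp
  · rw [← h]
    simp only [ne_eq, OfNat.ofNat_ne_zero, not_false_eq_true, zero_pow, zero_div, hW, not_true,
      Finset.filter_false, Finset.sum_empty, le_refl]
  have hVI : V ≤ I := by
    refine le_trans ?_ hI
    rw [hV]
    refine Finset.sum_le_sum fun k _ => ?_
    have : (1 : ℝ) ≤ 2 ^ k := one_le_pow₀ (by norm_num)
    nlinarith [hW k]
  have hIp : 0 < I := by linarith
  set d : ℝ := 4 * I / V with hd
  have hdp : 0 < d := by positivity
  rw [← Finset.sum_filter_add_sum_filter_not _ (fun k => d ≤ (2 : ℝ) ^ k)]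
  have b1 : ∑ k ∈ ((Finset.range N).filter (fun k => ¬ V ^ 2 / (16 * I) ≤ W k)).filter
      (fun k => d ≤ (2 : ℝ) ^ k), W k ≤ V / 4 := by
    have : d * ∑ k ∈ ((Finset.range N).filter (fun k => ¬ V ^ 2 / (16 * I) ≤ W k)).filter
      (fun k => d ≤ (2 : ℝ) ^ k), W k ≤ I := by
      refine le_trans ?_ hI
      rw [Finset.mul_sum]
      refine le_trans (Finset.sum_le_sum (g := fun k => (2 : ℝ) ^ k * W k) fun k hk => ?_) ?_
      · exact mul_le_mul_of_nonneg_right (Finset.mem_filter.mp hk).2 (hW k)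
      · refine Finset.sum_le_sum_of_subset_of_nonneg
          ((Finset.filter_subset _ _).trans (Finset.filter_subset _ _)) fun k _ _ => ?_
        have := hW k
        positivity
    have e : V / 4 = I / d := by rw [hd]; field_simp
    rw [e, le_div_iff₀ hdp, mul_comm]
    exact this
  have b2 : ∑ k ∈ ((Finset.range N).filter (fun k => ¬ V ^ 2 / (16 * I) ≤ W k)).filter
      (fun k => ¬ d ≤ (2 : ℝ) ^ k), W k ≤ V / 4 := by
    have hle := Finset.sum_le_card_nsmul (((Finset.range N).filter
      (fun k => ¬ V ^ 2 / (16 * I) ≤ W k)).filter (fun k => ¬ d ≤ (2 : ℝ) ^ k)) W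
      (V ^ 2 / (16 * I)) (fun k hk => by
        have := (Finset.mem_filter.mp (Finset.mem_filter.mp hk).1).2
        exact (not_le.mp this).le)
    have hcard : (((Finset.range N).filter
      (fun k => ¬ V ^ 2 / (16 * I) ≤ W k)).filter (fun k => ¬ d ≤ (2 : ℝ) ^ k)).card
        ≤ ⌊d⌋₊ := by
      rw [← Finset.card_range ⌊d⌋₊]
      refine Finset.card_le_card fun k hk => ?_
      have h1 := not_le.mp (Finset.mem_filter.mp hk).2
      rw [Finset.mem_range, ← Nat.succ_le_iff]
      refine Nat.le_floor ?_
      have : k + 1 ≤ 2 ^ k := Nat.lt_two_pow_self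
      have h3 : ((k + 1 : ℕ) : ℝ) ≤ 2 ^ k := by exact_mod_cast this
      exact h3.trans h1.le
    refine hle.trans ?_
    rw [nsmul_eq_mul]
    have hc : ((((Finset.range N).filter
      (fun k => ¬ V ^ 2 / (16 * I) ≤ W k)).filter (fun k => ¬ d ≤ (2 : ℝ) ^ k)).card : ℝ) ≤ d :=
      (Nat.cast_le.mpr hcard).trans (Nat.floor_le hdp.le)
    refine (mul_le_mul_of_nonneg_right hc (by positivity)).trans (le_of_eq ?_)
    rw [hd]; field_simp; norm_num
  linarith

end DM

open Classical in
/-- For `1 ≤ p < 2` and `0 ≤ T ≤ 1`, the dyadic levels `d` with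
`W_{≈d}(T) ≥ var(T)²/(16 Inf^p(T))` carry at least half of the variance. -/
theorem dyadic_mass {n : ℕ} (p : ℝ) (hp1 : 1 ≤ p) (hp2 : p < 2) (T : QM n)
    (h0 : T.PosSemidef) (h1 : ((1 : QM n) - T).PosSemidef) :
    QM.qvar T / 2 ≤
      ∑' k : ℕ,
        (if QM.qvar T ^ 2 / (16 * ∑ j, QM.snorm p (QM.djF j T) ^ p) ≤ QM.Wapprox T (2 ^ k)
          then QM.Wapprox T (2 ^ k) else 0) := by
  rw [tsum_eq_sum (s := Finset.range (n + 1))]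
  · set I := ∑ j, QM.snorm p (QM.djF j T) ^ p
    have hI : QM.InfF T ≤ I := DM.InfF_le hp1 hp2 h0 h1
    have hV := DM.var_eq_sum T
    have key := DM.abstract_mass (n + 1) (fun k => QM.Wapprox T (2 ^ k))
      (fun k => DM.W_nonneg T _) (QM.qvar T) I hV ((DM.sum_le_Inf T).trans hI)
    rw [← Finset.sum_filter]
    have hsplit := Finset.sum_filter_add_sum_filter_not (Finset.range (n + 1))
      (fun k => QM.qvar T ^ 2 / (16 * I) ≤ QM.Wapprox T (2 ^ k))
      (fun k => QM.Wapprox T (2 ^ k))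
    rw [← hV] at hsplit
    have key2 : ∑ k ∈ (Finset.range (n + 1)).filter
      (fun k => ¬ QM.qvar T ^ 2 / (16 * I) ≤ QM.Wapprox T (2 ^ k)), QM.Wapprox T (2 ^ k)
        ≤ QM.qvar T / 2 := by
      convert key
    have := hsplit
    linarith
  · intro k hk
    have : n + 1 ≤ k := by simpa using hk
    rw [DM.W_zero T this]
    simp
end
end

section
/- Let T ∈ M_{2^n} have Fourier degree at most k (T̂(s) = 0 whenever |supp(s)| > k). Then for every r ≥ 2, ‖T‖_r ≤ (r-1)^{k/2} ‖T‖₂. -/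
open scoped BigOperators ComplexOrder
open Matrix

noncomputable section

namespace MC
section
open Real MeasureTheory Set Filter Topology

theorem aux_int1 {p : ℝ} (hp1 : 1 < p) (hp2 : p < 2) {m : ℝ} (hm : 0 < m) :
    IntegrableOn (fun t : ℝ => t ^ (p - 2) / (m + t)) (Ioi 0) ∧
    ∫ t in Ioi (0:ℝ), t ^ (p - 2) / (m + t) =
      m ^ (p - 2) * ∫ t in Ioi (0:ℝ), rpowIntegrand₀₁ (p - 1) t 1 := by
  have hp : p - 1 ∈ Ioo (0:ℝ) 1 := ⟨by linarith, by linarith⟩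
  have e : EqOn (fun t : ℝ => m⁻¹ * rpowIntegrand₀₁ (p - 1) t m)
      (fun t : ℝ => t ^ (p - 2) / (m + t)) (Ioi 0) := by
    intro t ht
    have ht' : (0:ℝ) < t := ht
    simp only []
    rw [rpowIntegrand₀₁_eq_pow_div hp ht'.le hm.le]
    have : p - 1 - 1 = p - 2 := by ring
    rw [this]
    field_simp
    ring
  refine ⟨IntegrableOn.congr_fun ((integrableOn_rpowIntegrand₀₁_Ioi hp hm.le).const_mul m⁻¹) e
    measurableSet_Ioi, ?_⟩
  rw [← setIntegral_congr_fun measurableSet_Ioi e, integral_const_mul,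
    integral_rpowIntegrand₀₁_eq_rpow_mul_const hp hm.le, ← mul_assoc]
  congr 1
  rw [show p - 2 = (p - 1) - 1 by ring, rpow_sub_one hm.ne' (p - 1)]
  field_simp

theorem aux_int2 {p : ℝ} (hp1 : 1 < p) (hp2 : p < 2) {m : ℝ} (hm : 0 < m) :
    IntegrableOn (fun t : ℝ => 2 * t ^ p / (m + t) ^ 3) (Ioi 0) ∧
    ∫ t in Ioi (0:ℝ), 2 * t ^ p / (m + t) ^ 3 =
      p * (p - 1) * (m ^ (p - 2) * ∫ t in Ioi (0:ℝ), rpowIntegrand₀₁ (p - 1) t 1) := by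
  obtain ⟨hi, he⟩ := aux_int1 hp1 hp2 hm
  have hint : IntegrableOn (fun t : ℝ => 2 * t ^ p / (m + t) ^ 3) (Ioi 0) := by
    refine Integrable.mono' (hi.const_mul 2) ?_ ?_
    · apply ContinuousOn.aestronglyMeasurable _ measurableSet_Ioi
      intro t ht
      have ht' : (0:ℝ) < t := ht
      apply ContinuousAt.continuousWithinAt
      apply ContinuousAt.div
      · exact continuousAt_const.mul (continuousAt_id.rpow_const (Or.inl ht'.ne'))
      · fun_prop
      · positivity
    · refine (ae_restrict_iff' measurableSet_Ioi).2 (Eventually.of_forall ?_)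
      intro t ht
      have ht' : (0:ℝ) < t := ht
      rw [norm_of_nonneg (by positivity)]
      have : t ^ p = t ^ (p - 2) * t ^ 2 := by
        rw [← rpow_natCast t 2, ← rpow_add ht']; congr 1; norm_num
      rw [this, mul_div_assoc]
      gcongr 2 * ?_
      rw [div_le_div_iff₀ (by positivity) (by positivity)]
      have h1 : t ^ 2 ≤ (m + t) ^ 2 := by gcongr; linarith
      have h0 : 0 < t ^ (p - 2) := by positivity
      calc t ^ (p - 2) * t ^ 2 * (m + t) ≤ t ^ (p - 2) * (m + t) ^ 2 * (m + t) := by gcongr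
        _ = _ := by ring
  refine ⟨hint, ?_⟩
  have key := integral_Ioi_of_hasDerivAt_of_tendsto (a := (0:ℝ)) (m := (0:ℝ))
    (f := fun t => - t ^ p / (m + t) ^ 2 - p * t ^ (p - 1) / (m + t))
    (f' := fun t => 2 * t ^ p / (m + t) ^ 3 - p * (p - 1) * (t ^ (p - 2) / (m + t))) ?_ ?_ ?_ ?_
  · rw [integral_sub hint (hi.const_mul _), integral_const_mul, he] at key
    have h0 : (0:ℝ) ^ p = 0 := zero_rpow (by linarith)
    have h1 : (0:ℝ) ^ (p - 1) = 0 := zero_rpow (by linarith)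
    simp only [h0, h1] at key
    simp at key
    linarith
  · apply ContinuousAt.continuousWithinAt
    have c1 : ContinuousAt (fun t : ℝ => t ^ p) 0 := continuousAt_id.rpow_const (Or.inr (by linarith))
    have c2 : ContinuousAt (fun t : ℝ => t ^ (p - 1)) 0 :=
      continuousAt_id.rpow_const (Or.inr (by linarith))
    apply ContinuousAt.sub
    · apply c1.neg.div (by fun_prop); simp; exact hm.ne'
    · apply (continuousAt_const.mul c2).div (by fun_prop); simp; exact hm.ne'
  · intro t ht
    have ht' : (0:ℝ) < t := ht
    have hmt : m + t ≠ 0 := by positivity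
    have d1 := Real.hasDerivAt_rpow_const (x := t) (p := p) (Or.inl ht'.ne')
    have d2 := Real.hasDerivAt_rpow_const (x := t) (p := p - 1) (Or.inl ht'.ne')
    have d3 : HasDerivAt (fun t : ℝ => m + t) 1 t := by simpa using (hasDerivAt_id t).const_add m
    have := ((d1.neg.div (d3.pow 2) (pow_ne_zero 2 hmt))).sub ((d2.const_mul p).div d3 hmt)
    refine this.congr_deriv ?_
    have e1 : t ^ p = t ^ (p - 2) * t ^ 2 := by
      rw [← rpow_natCast t 2, ← rpow_add ht']; congr 1; norm_num
    have e2 : t ^ (p - 1) = t ^ (p - 2) * t := by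
      rw [← rpow_add_one ht'.ne']; congr 1; ring
    have e3 : p - 1 - 1 = p - 2 := by ring
    simp only [Pi.neg_apply, Pi.pow_apply, e1, e2, e3]
    field_simp
    ring
  · exact hint.sub (hi.const_mul _)
  · have t1 : Tendsto (fun t : ℝ => t ^ (p - 2)) atTop (𝓝 0) := by
      have := tendsto_rpow_neg_atTop (y := 2 - p) (by linarith)
      simpa using this
    have t2 : Tendsto (fun t : ℝ => t / (m + t)) atTop (𝓝 1) := by
      have h : Tendsto (fun t : ℝ => 1 - m * (m + t)⁻¹) atTop (𝓝 (1 - m * 0)) := by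
        apply Tendsto.sub tendsto_const_nhds
        apply Tendsto.mul tendsto_const_nhds
        exact tendsto_inv_atTop_zero.comp (tendsto_atTop_add_const_left _ _ tendsto_id)
      simp at h
      refine h.congr' ?_
      filter_upwards [eventually_gt_atTop 0] with t ht
      have : m + t ≠ 0 := by positivity
      field_simp
      ring
    have t3 := ((t1.mul (t2.pow 2)).neg).sub ((t1.mul t2).const_mul p)
    simp only [mul_one, one_pow, neg_zero, mul_zero, sub_zero] at t3
    refine t3.congr' ?_
    filter_upwards [eventually_gt_atTop 0] with t ht
    have e1 : t ^ p = t ^ (p - 2) * t ^ 2 := by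
      rw [← rpow_natCast t 2, ← rpow_add ht]; congr 1; norm_num
    have e2 : t ^ (p - 1) = t ^ (p - 2) * t := by
      rw [← rpow_add_one ht.ne']; congr 1; ring
    rw [e1, e2]
    have : m + t ≠ 0 := by positivity
    field_simp

theorem aux_int3 {p : ℝ} (hp1 : 1 < p) (hp2 : p < 2) {x : ℝ} (hx : 0 ≤ x) :
    IntegrableOn (fun t : ℝ => t ^ (p - 2) * (x ^ 2 / (x + t))) (Ioi 0) ∧
    ∫ t in Ioi (0:ℝ), t ^ (p - 2) * (x ^ 2 / (x + t)) =
      x ^ p * ∫ t in Ioi (0:ℝ), rpowIntegrand₀₁ (p - 1) t 1 := by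
  rcases hx.eq_or_lt with rfl | hx
  · simp [zero_rpow (show p ≠ 0 by linarith)]
  obtain ⟨hi, he⟩ := aux_int1 hp1 hp2 hx
  have e : (fun t : ℝ => t ^ (p - 2) * (x ^ 2 / (x + t))) =
      fun t : ℝ => x ^ 2 * (t ^ (p - 2) / (x + t)) := by
    ext t; ring
  rw [e]
  refine ⟨hi.const_mul _, ?_⟩
  rw [integral_const_mul, he, ← mul_assoc]
  congr 1
  rw [← rpow_natCast x 2, ← rpow_add hx]; congr 1; norm_num

theorem aux_scalar {ι : Type*} [Fintype ι] {p : ℝ} (hp1 : 1 < p) (hp2 : p < 2)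
    (u v a m b : ι → ℝ) (hu : ∀ i, 0 ≤ u i) (hv : ∀ i, 0 ≤ v i) (ha : ∀ i, 0 ≤ a i)
    (hm : ∀ i, 0 ≤ m i) (hb : ∀ i, m i = 0 → b i = 0)
    (htr : ∑ i, u i + ∑ i, v i = 2 * ∑ i, a i)
    (hres : ∀ t : ℝ, 0 < t → 2 * ∑ i, 1 / (a i + t) + 2 * ∑ i, b i ^ 2 / (m i + t) ^ 3 ≤
      ∑ i, 1 / (u i + t) + ∑ i, 1 / (v i + t)) :
    2 * ∑ i, a i ^ p + p * (p - 1) * ∑ i, b i ^ 2 * m i ^ (p - 2) ≤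
      ∑ i, u i ^ p + ∑ i, v i ^ p := by
  set C := ∫ t in Ioi (0:ℝ), rpowIntegrand₀₁ (p - 1) t 1 with hC
  have hp : p - 1 ∈ Ioo (0:ℝ) 1 := ⟨by linarith, by linarith⟩
  have hCpos : 0 < C := integral_rpowIntegrand₀₁_one_pos hp
  have hx : ∀ w : ι → ℝ, (∀ i, 0 ≤ w i) →
      IntegrableOn (fun t : ℝ => ∑ i, t ^ (p - 2) * (w i ^ 2 / (w i + t))) (Ioi 0) ∧
      ∫ t in Ioi (0:ℝ), ∑ i, t ^ (p - 2) * (w i ^ 2 / (w i + t)) = (∑ i, w i ^ p) * C := by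
    intro w hw
    refine ⟨integrable_finsetSum _ fun i _ => (aux_int3 hp1 hp2 (hw i)).1, ?_⟩
    rw [integral_finsetSum _ fun i _ => (aux_int3 hp1 hp2 (hw i)).1, Finset.sum_mul]
    exact Finset.sum_congr rfl fun i _ => (aux_int3 hp1 hp2 (hw i)).2
  have hy1 : ∀ i, IntegrableOn (fun t : ℝ => b i ^ 2 * (2 * t ^ p / (m i + t) ^ 3)) (Ioi 0) ∧
      ∫ t in Ioi (0:ℝ), b i ^ 2 * (2 * t ^ p / (m i + t) ^ 3) =
        p * (p - 1) * (b i ^ 2 * m i ^ (p - 2)) * C := by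
    intro i
    rcases (hm i).eq_or_lt with h | h
    · simp [hb i h.symm]
    · refine ⟨(aux_int2 hp1 hp2 h).1.const_mul _, ?_⟩
      rw [integral_const_mul, (aux_int2 hp1 hp2 h).2]
      ring
  have hyI : IntegrableOn (fun t : ℝ => ∑ i, b i ^ 2 * (2 * t ^ p / (m i + t) ^ 3)) (Ioi 0) :=
    integrable_finsetSum _ fun i _ => (hy1 i).1
  have hyE : ∫ t in Ioi (0:ℝ), ∑ i, b i ^ 2 * (2 * t ^ p / (m i + t) ^ 3) =
      (p * (p - 1) * ∑ i, b i ^ 2 * m i ^ (p - 2)) * C := by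
    rw [integral_finsetSum _ fun i _ => (hy1 i).1, Finset.mul_sum, Finset.sum_mul]
    exact Finset.sum_congr rfl fun i _ => (hy1 i).2
  have main : ∫ t in Ioi (0:ℝ), (2 * (∑ i, t ^ (p - 2) * (a i ^ 2 / (a i + t))) +
        ∑ i, b i ^ 2 * (2 * t ^ p / (m i + t) ^ 3)) ≤
      ∫ t in Ioi (0:ℝ), ((∑ i, t ^ (p - 2) * (u i ^ 2 / (u i + t))) +
        ∑ i, t ^ (p - 2) * (v i ^ 2 / (v i + t))) := by
    refine setIntegral_mono_on (((hx a ha).1.const_mul 2).add hyI) ((hx u hu).1.add (hx v hv).1)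
      measurableSet_Ioi ?_
    intro t ht
    have ht' : (0:ℝ) < t := ht
    have hs : ∀ w : ι → ℝ, (∀ i, 0 ≤ w i) → ∑ i, t ^ (p - 2) * (w i ^ 2 / (w i + t)) =
        t ^ (p - 2) * (∑ i, w i - (Fintype.card ι) * t + t ^ 2 * ∑ i, 1 / (w i + t)) := by
      intro w hw
      rw [← Finset.mul_sum]
      congr 1
      have : ∀ i, w i ^ 2 / (w i + t) = w i - t + t ^ 2 * (1 / (w i + t)) := by
        intro i
        have : w i + t ≠ 0 := by have := hw i; positivity
        field_simp
        ring
      simp only [this, Finset.sum_add_distrib, Finset.sum_sub_distrib, Finset.mul_sum]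
      simp
    have hs2 : ∑ i, b i ^ 2 * (2 * t ^ p / (m i + t) ^ 3) =
        t ^ (p - 2) * (t ^ 2 * (2 * ∑ i, b i ^ 2 / (m i + t) ^ 3)) := by
      have e1 : t ^ p = t ^ (p - 2) * t ^ 2 := by
        rw [← rpow_natCast t 2, ← rpow_add ht']; congr 1; norm_num
      simp only [Finset.mul_sum, e1]
      exact Finset.sum_congr rfl fun i _ => by ring
    rw [hs a ha, hs u hu, hs v hv, hs2]
    have h0 : 0 < t ^ (p - 2) := by positivity
    have h3 := mul_le_mul_of_nonneg_left (hres t ht') (sq_nonneg t)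
    have : t ^ (p - 2) * (2 * (∑ i, a i - (Fintype.card ι) * t + t ^ 2 * ∑ i, 1 / (a i + t)) +
        (t ^ 2 * (2 * ∑ i, b i ^ 2 / (m i + t) ^ 3))) ≤
        t ^ (p - 2) * ((∑ i, u i - (Fintype.card ι) * t + t ^ 2 * ∑ i, 1 / (u i + t)) +
        (∑ i, v i - (Fintype.card ι) * t + t ^ 2 * ∑ i, 1 / (v i + t))) := by
      apply mul_le_mul_of_nonneg_left _ h0.le
      nlinarith
    linarith
  rw [integral_add ((hx a ha).1.const_mul 2) hyI, integral_add (hx u hu).1 (hx v hv).1,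
    integral_const_mul, (hx a ha).2, (hx u hu).2, (hx v hv).2, hyE] at main
  have : (2 * ∑ i, a i ^ p + p * (p - 1) * ∑ i, b i ^ 2 * m i ^ (p - 2)) * C ≤
      (∑ i, u i ^ p + ∑ i, v i ^ p) * C := by linarith
  exact le_of_mul_le_mul_right this hCpos

end


section
variable {ι κ : Type*} [Fintype ι] [DecidableEq ι] [Fintype κ]

/-- Sum of `f` over the real parts of the roots of the characteristic polynomial. -/
noncomputable def trf (f : ℝ → ℝ) (M : Matrix ι ι ℂ) : ℝ :=
  (M.charpoly.roots.map (fun z => f z.re)).sum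

theorem trf_of_charpoly (f : ℝ → ℝ) (M : Matrix ι ι ℂ) (d : κ → ℝ)
    (h : M.charpoly = ∏ i, (Polynomial.X - Polynomial.C (d i : ℂ))) :
    trf f M = ∑ i, f (d i) := by
  unfold trf
  rw [h, Polynomial.roots_prod _ _ (Finset.prod_ne_zero_iff.2 fun i _ => Polynomial.X_sub_C_ne_zero _)]
  simp [Polynomial.roots_X_sub_C, Multiset.bind_singleton]

theorem charpoly_conj_diag (U : Matrix ι ι ℂ) (hU : Uᴴ * U = 1) (d : ι → ℂ) :
    (U * diagonal d * Uᴴ).charpoly = ∏ i, (Polynomial.X - Polynomial.C (d i)) := by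
  rw [charpoly_mul_comm, ← mul_assoc, hU, one_mul, charpoly_diagonal]

/-- Unnormalised `p`-th power of the Schatten norm. -/
noncomputable def Sp (p : ℝ) (T : Matrix ι ι ℂ) : ℝ := trf (fun x => Real.sqrt x ^ p) (Tᴴ * T)

theorem Sp_svd (p : ℝ) (U V : Matrix ι ι ℂ) (d : ι → ℝ) (hU : Uᴴ * U = 1) (hV : Vᴴ * V = 1) :
    Sp p (U * diagonal (fun i => (d i : ℂ)) * Vᴴ) = ∑ i, |d i| ^ p := by
  unfold Sp
  have : (U * diagonal (fun i => (d i : ℂ)) * Vᴴ)ᴴ * (U * diagonal (fun i => (d i : ℂ)) * Vᴴ) =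
      V * diagonal (fun i => ((d i ^ 2 : ℝ) : ℂ)) * Vᴴ := by
    have e : (diagonal (fun i => (d i : ℂ)))ᴴ = diagonal (fun i => (d i : ℂ)) := by
      rw [diagonal_conjTranspose]; congr 1; ext i; simp
    have e2 : diagonal (fun i => ((d i ^ 2 : ℝ) : ℂ)) =
      diagonal (fun i => (d i : ℂ)) * diagonal (fun i => (d i : ℂ)) := by
      rw [diagonal_mul_diagonal]; congr 1; ext i; push_cast; ring
    rw [conjTranspose_mul, conjTranspose_mul, conjTranspose_conjTranspose, e, e2]
    calc _ = V * diagonal (fun i => (d i : ℂ)) * (Uᴴ * U) * diagonal (fun i => (d i : ℂ)) * Vᴴ := by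
          simp only [mul_assoc]
      _ = _ := by rw [hU, mul_one]; simp only [mul_assoc]
  rw [this, trf_of_charpoly _ _ _ (charpoly_conj_diag V hV _)]
  simp [Real.sqrt_sq_eq_abs]

theorem spec_herm {A : Matrix ι ι ℂ} (hA : A.IsHermitian) :
    ∃ (U : Matrix ι ι ℂ) (d : ι → ℝ), Uᴴ * U = 1 ∧ A = U * diagonal (fun i => (d i : ℂ)) * Uᴴ := by
  refine ⟨hA.eigenvectorUnitary, hA.eigenvalues, ?_, ?_⟩
  · exact Unitary.coe_star_mul_self hA.eigenvectorUnitary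
  · conv_lhs => rw [hA.spectral_theorem, Unitary.conjStarAlgAut_apply]
    rfl

theorem spec_psd {A : Matrix ι ι ℂ} (hA : A.PosSemidef) :
    ∃ (U : Matrix ι ι ℂ) (d : ι → ℝ), Uᴴ * U = 1 ∧ (∀ i, 0 ≤ d i) ∧
      A = U * diagonal (fun i => (d i : ℂ)) * Uᴴ := by
  refine ⟨hA.1.eigenvectorUnitary, hA.1.eigenvalues, ?_, hA.eigenvalues_nonneg, ?_⟩
  · exact Unitary.coe_star_mul_self hA.1.eigenvectorUnitary
  · conv_lhs => rw [hA.1.spectral_theorem, Unitary.conjStarAlgAut_apply]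
    rfl

theorem Sp_conj (p : ℝ) (W T : Matrix ι ι ℂ) (hW : Wᴴ * W = 1) :
    Sp p (W * T * Wᴴ) = Sp p T := by
  unfold Sp trf
  have : (W * T * Wᴴ)ᴴ * (W * T * Wᴴ) = W * (Tᴴ * T) * Wᴴ := by
    rw [conjTranspose_mul, conjTranspose_mul, conjTranspose_conjTranspose]
    calc _ = W * Tᴴ * (Wᴴ * W) * T * Wᴴ := by simp only [mul_assoc]
      _ = _ := by rw [hW, mul_one]; simp only [mul_assoc]
  rw [this, charpoly_mul_comm, ← mul_assoc, hW, one_mul]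

theorem trace_conj_diag (U : Matrix ι ι ℂ) (hU : Uᴴ * U = 1) (d : ι → ℝ) :
    (trace (U * diagonal (fun i => (d i : ℂ)) * Uᴴ)).re = ∑ i, d i := by
  rw [trace_mul_comm, ← mul_assoc, hU, one_mul, trace_diagonal]
  simp

theorem var_ineq {M R W : Matrix ι ι ℂ} (hM : M.PosSemidef) (hR : R.IsHermitian)
    (hW : W.IsHermitian) (h : M * R = 1) :
    2 * (trace W).re - (trace (W * M * W)).re ≤ (trace R).re := by
  have h' : R * M = 1 := mul_eq_one_comm.1 h
  have := (hM.conjTranspose_mul_mul_same (W - R)).trace_nonneg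
  rw [conjTranspose_sub, hW.eq, hR.eq] at this
  have e : (W - R) * M * (W - R) = W * M * W - W - W + R := by
    have : (W - R) * M * (W - R) = W * M * W - W * (M * R) - (R * M) * W + (R * M) * R := by
      noncomm_ring
    rw [this, h, h']; simp
  rw [e] at this
  have h2 := (Complex.le_def.1 this).1
  simp only [trace_add, trace_sub, Complex.add_re, Complex.sub_re, Complex.zero_re] at h2
  linarith

theorem diag_ineq {M R : Matrix ι ι ℂ} (hM : M.PosSemidef) (hR : R.IsHermitian)
    (h : M * R = 1) (k : ι) (hk : 0 < (M k k).re) : 1 / (M k k).re ≤ (R k k).re := by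
  have h' : R * M = 1 := mul_eq_one_comm.1 h
  set s : ℝ := 1 / (M k k).re with hs
  have := (hM.conjTranspose_mul_mul_same (R - (s : ℂ) • 1)).diag_nonneg (i := k)
  rw [conjTranspose_sub, hR.eq, conjTranspose_smul, conjTranspose_one] at this
  have e : (R - star (s : ℂ) • 1) * M * (R - (s : ℂ) • 1) =
      R - (s : ℂ) • 1 - (s : ℂ) • 1 + ((s : ℂ) * s) • M := by
    have e0 : star (s : ℂ) = s := by simp
    rw [e0, sub_mul, h', sub_mul, mul_sub, mul_sub]
    simp only [smul_mul_assoc, mul_smul_comm, one_mul, mul_one, h, smul_smul]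
    abel
  rw [e] at this
  have h2 := (Complex.le_def.1 this).1
  simp at h2
  have : s * (M k k).re = 1 := by rw [hs]; field_simp
  rw [mul_assoc, this] at h2
  linarith

/-- the resolvent. -/
theorem resolv (U : Matrix ι ι ℂ) (d : ι → ℝ) (hU : Uᴴ * U = 1) (hd : ∀ i, 0 ≤ d i)
    (t : ℝ) (ht : 0 < t) :
    ∃ R : Matrix ι ι ℂ, R.IsHermitian ∧
      (U * diagonal (fun i => (d i : ℂ)) * Uᴴ + (t : ℂ) • 1) * R = 1 ∧
      (trace R).re = ∑ i, 1 / (d i + t) := by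
  have hU' : U * Uᴴ = 1 := mul_eq_one_comm.1 hU
  refine ⟨U * diagonal (fun i => ((1 / (d i + t) : ℝ) : ℂ)) * Uᴴ, ?_, ?_, trace_conj_diag U hU _⟩
  · unfold IsHermitian
    rw [conjTranspose_mul, conjTranspose_mul, conjTranspose_conjTranspose, diagonal_conjTranspose,
      mul_assoc]
    congr 3
    ext i; simp
  · have : U * diagonal (fun i => (d i : ℂ)) * Uᴴ + (t : ℂ) • 1 =
        U * diagonal (fun i => ((d i + t : ℝ) : ℂ)) * Uᴴ := by
      have e : diagonal (fun i => ((d i + t : ℝ) : ℂ)) = diagonal (fun i => (d i : ℂ)) + (t : ℂ) • 1 := by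
        ext i j
        by_cases hij : i = j
        · subst hij; simp
        · simp [hij]
      rw [e, mul_add, add_mul, mul_smul_comm, smul_mul_assoc, mul_one, hU']
    rw [this]
    calc _ = U * diagonal (fun i => ((d i + t : ℝ) : ℂ)) * (Uᴴ * U) *
          diagonal (fun i => ((1 / (d i + t) : ℝ) : ℂ)) * Uᴴ := by simp only [mul_assoc]
      _ = 1 := by
        rw [hU, mul_one, mul_assoc U, diagonal_mul_diagonal]
        have : (fun i => ((d i + t : ℝ) : ℂ) * ((1 / (d i + t) : ℝ) : ℂ)) = fun i => 1 := by
          ext i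
          rw [← Complex.ofReal_mul, mul_one_div_cancel (by have := hd i; positivity)]; simp
        rw [this, diagonal_one, mul_one, hU']

theorem core_res {A : Matrix ι ι ℂ} (b : ι → ℝ) (hA : A.PosSemidef)
    (hU : (A + diagonal (fun i => (b i : ℂ))).PosSemidef)
    (hV : (A - diagonal (fun i => (b i : ℂ))).PosSemidef)
    (t : ℝ) (ht : 0 < t) (RA RU RV : Matrix ι ι ℂ) (hRA : RA.IsHermitian) (hRU : RU.IsHermitian)
    (hRV : RV.IsHermitian) (eA : (A + (t : ℂ) • 1) * RA = 1)
    (eU : (A + diagonal (fun i => (b i : ℂ)) + (t : ℂ) • 1) * RU = 1)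
    (eV : (A - diagonal (fun i => (b i : ℂ)) + (t : ℂ) • 1) * RV = 1) :
    2 * (trace RA).re + 2 * ∑ i, b i ^ 2 / ((A i i).re + t) ^ 3 ≤ (trace RU).re + (trace RV).re := by
  have hdiag : ∀ i, 0 ≤ (A i i).re := fun i => (Complex.le_def.1 (hA.diag_nonneg (i := i))).1
  have ht1 : ((t : ℂ) • (1 : Matrix ι ι ℂ)).PosSemidef :=
    PosSemidef.one.smul (by exact_mod_cast ht.le)
  set M := A + (t : ℂ) • 1 with hM
  set B : Matrix ι ι ℂ := diagonal (fun i => (b i : ℂ)) with hB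
  have hMp : M.PosSemidef := hA.add ht1
  have hm : ∀ i, (M i i).re = (A i i).re + t := by intro i; simp [hM]
  have hmp : ∀ i, 0 < (M i i).re := by intro i; rw [hm]; have := hdiag i; linarith
  set w : ι → ℝ := fun i => b i / (M i i).re ^ 2 with hw
  set S : Matrix ι ι ℂ := diagonal (fun i => (w i : ℂ)) with hS
  have hSh : S.IsHermitian := by
    unfold IsHermitian
    rw [hS, diagonal_conjTranspose]; congr 1; ext i; simp
  have eU' : (M + B) * RU = 1 := by rw [← eU]; congr 1; rw [hM]; abel
  have eV' : (M - B) * RV = 1 := by rw [← eV]; congr 1; rw [hM]; abel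
  have pU : (M + B).PosSemidef := by
    have := hU.add ht1
    rwa [show A + B + (t : ℂ) • 1 = M + B by rw [hM]; abel] at this
  have pV : (M - B).PosSemidef := by
    have := hV.add ht1
    rwa [show A - B + (t : ℂ) • 1 = M - B by rw [hM]; abel] at this
  have i1 := var_ineq pU hRU (hRA.sub hSh) eU'
  have i2 := var_ineq pV hRV (hRA.add hSh) eV'
  have eq : (RA - S) * (M + B) * (RA - S) + (RA + S) * (M - B) * (RA + S) =
      2 • RA + 2 • (S * M * S) - 2 • (S * B * RA + RA * (B * S)) := by
    have : (RA - S) * (M + B) * (RA - S) + (RA + S) * (M - B) * (RA + S) =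
      2 • (RA * (M * RA)) + 2 • (S * M * S) - 2 • (S * B * RA + RA * (B * S)) := by noncomm_ring
    rw [this, eA, mul_one]
  have eq2 := congrArg (fun X => (trace X).re) eq
  simp only [two_nsmul, trace_add, trace_sub, Complex.add_re, Complex.sub_re] at eq2
  have t1 : (trace (S * M * S)).re = ∑ i, w i ^ 2 * (M i i).re := by
    simp only [trace, hS, diag_apply, mul_diagonal, diagonal_mul, Complex.re_sum]
    refine Finset.sum_congr rfl fun i _ => ?_
    simp [Complex.mul_re]; ring
  have t2 : (trace (S * B * RA)).re = ∑ i, w i * b i * (RA i i).re := by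
    simp only [trace, hS, hB, diagonal_mul_diagonal, diag_apply, diagonal_mul, Complex.re_sum]
    refine Finset.sum_congr rfl fun i _ => ?_
    simp [Complex.mul_re]
  have t3 : (trace (RA * (B * S))).re = ∑ i, w i * b i * (RA i i).re := by
    simp only [trace, hS, hB, diagonal_mul_diagonal, diag_apply, mul_diagonal, Complex.re_sum]
    refine Finset.sum_congr rfl fun i _ => ?_
    simp [Complex.mul_re]; ring
  rw [t1, t2, t3] at eq2
  simp only [trace_add, trace_sub, Complex.add_re, Complex.sub_re] at i1 i2
  have fin : ∑ i, b i ^ 2 / ((A i i).re + t) ^ 3 ≤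
      ∑ i, (2 * (w i * b i * (RA i i).re) - w i ^ 2 * (M i i).re) := by
    refine Finset.sum_le_sum fun i _ => ?_
    have h1 := diag_ineq hMp hRA eA i (hmp i)
    rw [← hm]
    have hp := hmp i
    have hwi : w i = b i / (M i i).re ^ 2 := rfl
    rw [hwi]
    generalize (M i i).re = m at *
    have : b i / m ^ 2 * b i * (1 / m) ≤ b i / m ^ 2 * b i * (RA i i).re := by
      apply mul_le_mul_of_nonneg_left h1
      have : b i / m ^ 2 * b i = (b i / m) ^ 2 := by ring
      rw [this]; positivity
    have e : b i ^ 2 / m ^ 3 = 2 * (b i / m ^ 2 * b i * (1 / m)) - (b i / m ^ 2) ^ 2 * m := by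
      field_simp; ring
    rw [e]; linarith
  rw [Finset.sum_sub_distrib, ← Finset.mul_sum] at fin
  linarith
end

end MC

namespace MC
section
variable {ι κ : Type*} [Fintype ι] [DecidableEq ι] [Fintype κ]

theorem Sp_nonneg (p : ℝ) (T : Matrix ι ι ℂ) : 0 ≤ Sp p T := by
  unfold Sp trf
  apply Multiset.sum_nonneg
  intro x hx
  obtain ⟨z, _, rfl⟩ := Multiset.mem_map.1 hx
  positivity

theorem diag_sum_le {p : ℝ} (hp1 : 1 < p) {A : Matrix ι ι ℂ} (hA : A.PosSemidef) :
    ∑ i, (A i i).re ^ p ≤ Sp p A := by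
  obtain ⟨U, d, hU, hd, e⟩ := spec_psd hA
  have hU' : U * Uᴴ = 1 := mul_eq_one_comm.1 hU
  have hS : Sp p A = ∑ i, d i ^ p := by
    rw [e, Sp_svd p U U d hU hU]
    exact Finset.sum_congr rfl fun i _ => by rw [abs_of_nonneg (hd i)]
  have hrow : ∀ k, ∑ i, Complex.normSq (U k i) = 1 := by
    intro k
    have := congrFun (congrFun hU' k) k
    simp only [mul_apply, conjTranspose_apply, one_apply_eq] at this
    have h2 := congrArg Complex.re this
    simpa [Complex.re_sum, Complex.normSq_apply] using h2
  have hcol : ∀ i, ∑ k, Complex.normSq (U k i) = 1 := by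
    intro k
    have := congrFun (congrFun hU k) k
    simp only [mul_apply, conjTranspose_apply, one_apply_eq] at this
    have h2 := congrArg Complex.re this
    simpa [Complex.re_sum, Complex.normSq_apply] using h2
  have hm : ∀ k, (A k k).re = ∑ i, Complex.normSq (U k i) * d i := by
    intro k
    rw [e, mul_apply, Complex.re_sum]
    refine Finset.sum_congr rfl fun i _ => ?_
    rw [mul_diagonal, conjTranspose_apply]
    simp [Complex.normSq_apply, Complex.mul_re]
    ring
  rw [hS]
  calc ∑ k, (A k k).re ^ p ≤ ∑ k, ∑ i, Complex.normSq (U k i) * d i ^ p := by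
        refine Finset.sum_le_sum fun k _ => ?_
        rw [hm]
        have := (convexOn_rpow hp1.le).map_sum_le (t := Finset.univ)
          (w := fun i => Complex.normSq (U k i)) (p := d) (fun i _ => Complex.normSq_nonneg _)
          (hrow k) (fun i _ => hd i)
        simpa using this
    _ = ∑ i, d i ^ p := by
        rw [Finset.sum_comm]
        refine Finset.sum_congr rfl fun i _ => ?_
        rw [← Finset.sum_mul, hcol, one_mul]

theorem Sp_eq_of_psd (p : ℝ) {A U : Matrix ι ι ℂ} {d : ι → ℝ} (hU : Uᴴ * U = 1) (hd : ∀ i, 0 ≤ d i)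
    (e : A = U * diagonal (fun i => (d i : ℂ)) * Uᴴ) : Sp p A = ∑ i, d i ^ p := by
  rw [e, Sp_svd p U U d hU hU]
  exact Finset.sum_congr rfl fun i _ => by rw [abs_of_nonneg (hd i)]

theorem psd_avg {A B : Matrix ι ι ℂ} (hU : (A + B).PosSemidef) (hV : (A - B).PosSemidef) :
    A.PosSemidef := by
  have := (hU.add hV).smul (a := ((1/2 : ℝ) : ℂ)) (by
    rw [Complex.zero_le_real]; norm_num)
  convert this using 1
  ext i j
  simp
  ring

theorem bcl_diag {p : ℝ} (hp1 : 1 < p) (hp2 : p < 2) {A : Matrix ι ι ℂ} (b : ι → ℝ)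
    (hU : (A + diagonal (fun i => (b i : ℂ))).PosSemidef)
    (hV : (A - diagonal (fun i => (b i : ℂ))).PosSemidef) :
    2 * Sp p A + p * (p - 1) * ∑ i, b i ^ 2 * (A i i).re ^ (p - 2) ≤
      Sp p (A + diagonal (fun i => (b i : ℂ))) + Sp p (A - diagonal (fun i => (b i : ℂ))) := by
  have hA := psd_avg hU hV
  obtain ⟨WA, a, hWA, ha, eA⟩ := spec_psd hA
  obtain ⟨WU, u, hWU, hu, eU⟩ := spec_psd hU
  obtain ⟨WV, v, hWV, hv, eV⟩ := spec_psd hV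
  rw [Sp_eq_of_psd p hWA ha eA, Sp_eq_of_psd p hWU hu eU, Sp_eq_of_psd p hWV hv eV]
  have h1 : ∀ i, 0 ≤ (A i i).re + b i := fun i => by
    simpa using (Complex.le_def.1 (hU.diag_nonneg (i := i))).1
  have h2 : ∀ i, 0 ≤ (A i i).re - b i := fun i => by
    simpa using (Complex.le_def.1 (hV.diag_nonneg (i := i))).1
  refine aux_scalar hp1 hp2 u v a _ b hu hv ha (fun i => by linarith [h1 i, h2 i])
    (fun i h => by linarith [h1 i, h2 i]) ?_ ?_
  · rw [← trace_conj_diag WU hWU u, ← trace_conj_diag WV hWV v, ← trace_conj_diag WA hWA a,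
      ← eU, ← eV, ← eA]
    simp
    ring
  · intro t ht
    obtain ⟨RA, hRA, qA, tA⟩ := resolv WA a hWA ha t ht
    obtain ⟨RU, hRU, qU, tU⟩ := resolv WU u hWU hu t ht
    obtain ⟨RV, hRV, qV, tV⟩ := resolv WV v hWV hv t ht
    rw [← tA, ← tU, ← tV]
    rw [← eA] at qA
    rw [← eU] at qU
    rw [← eV] at qV
    exact core_res b hA hU hV t ht RA RU RV hRA hRU hRV qA qU qV

theorem holder_aux {p : ℝ} (hp1 : 1 < p) (hp2 : p < 2) (b m : ι → ℝ) (hm : ∀ i, 0 ≤ m i)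
    (hb : ∀ i, m i = 0 → b i = 0) :
    ∑ i, |b i| ^ p ≤ (∑ i, b i ^ 2 * m i ^ (p - 2)) ^ (p / 2) * (∑ i, m i ^ p) ^ ((2 - p) / 2) := by
  have hc : (2 / p).HolderConjugate (2 / (2 - p)) := by
    rw [Real.holderConjugate_iff]
    constructor
    · rw [lt_div_iff₀ (by linarith)]; linarith
    · field_simp; ring
  have := Real.inner_le_Lp_mul_Lq_of_nonneg Finset.univ hc
    (f := fun i => (b i ^ 2 * m i ^ (p - 2)) ^ (p / 2)) (g := fun i => m i ^ (p * (2 - p) / 2))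
    (fun i _ => by have := hm i; positivity) (fun i _ => by have := hm i; positivity)
  have e1 : ∀ i, ((b i ^ 2 * m i ^ (p - 2)) ^ (p / 2)) ^ (2 / p) = b i ^ 2 * m i ^ (p - 2) := by
    intro i
    have := hm i
    rw [← Real.rpow_mul (by positivity)]
    rw [show p / 2 * (2 / p) = 1 by field_simp, Real.rpow_one]
  have e2 : ∀ i, (m i ^ (p * (2 - p) / 2)) ^ (2 / (2 - p)) = m i ^ p := by
    intro i
    rw [← Real.rpow_mul (hm i)]
    congr 1
    have : 2 - p ≠ 0 := by linarith
    field_simp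
  have e3 : ∀ i, (b i ^ 2 * m i ^ (p - 2)) ^ (p / 2) * m i ^ (p * (2 - p) / 2) = |b i| ^ p := by
    intro i
    rcases (hm i).eq_or_lt with h | h
    · rw [hb i h.symm]
      have : p / 2 ≠ 0 := by linarith
      have h' : p ≠ 0 := by linarith
      simp [Real.zero_rpow this, Real.zero_rpow h']
    · rw [Real.mul_rpow (by positivity) (by positivity), mul_assoc, ← Real.rpow_mul h.le,
        ← Real.rpow_add h, show (p - 2) * (p / 2) + p * (2 - p) / 2 = 0 by ring, Real.rpow_zero,
        mul_one, ← sq_abs, ← Real.rpow_natCast, ← Real.rpow_mul (abs_nonneg _)]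
      congr 1
      push_cast; ring
  simp only [e1, e2, e3] at this
  rw [one_div_div, one_div_div] at this
  exact this

theorem scal_final {p : ℝ} (hp1 : 1 < p) (hp2 : p < 2) {a q b s : ℝ} (ha : 0 ≤ a) (hq : 0 ≤ q)
    (hb0 : 0 ≤ b) (hs0 : 0 ≤ s)
    (hb : b ≤ q ^ (p / 2) * a ^ ((2 - p) / 2)) (hs : a + p * (p - 1) / 2 * q ≤ s) :
    a ^ (2 / p) + (p - 1) * b ^ (2 / p) ≤ s ^ (2 / p) := by
  have hp0 : 0 < p := by linarith
  rcases ha.eq_or_lt with h | h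
  · subst h
    rw [Real.zero_rpow (by linarith : (2 - p) / 2 ≠ 0), mul_zero] at hb
    have : b = 0 := le_antisymm hb hb0
    have h2 : 2 / p ≠ 0 := by positivity
    rw [this, Real.zero_rpow h2]
    simp; positivity
  · have hb' : b ^ (2 / p) ≤ q * (a ^ (2 / p) / a) := by
      calc b ^ (2 / p) ≤ (q ^ (p / 2) * a ^ ((2 - p) / 2)) ^ (2 / p) :=
            Real.rpow_le_rpow hb0 hb (by positivity)
        _ = q * (a ^ (2 / p) / a) := by
            rw [Real.mul_rpow (by positivity) (by positivity), ← Real.rpow_mul hq,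
              ← Real.rpow_mul h.le, show p / 2 * (2 / p) = 1 by field_simp, Real.rpow_one,
              ← Real.rpow_sub_one h.ne']
            congr 2
            field_simp
    have h1 : a ^ (2 / p) * (1 + (p - 1) * (q / a)) ≤ s ^ (2 / p) := by
      calc a ^ (2 / p) * (1 + (p - 1) * (q / a))
          = a ^ (2 / p) * (1 + (2 / p) * (p * (p - 1) / 2 * q / a)) := by congr 2; field_simp
        _ ≤ a ^ (2 / p) * (1 + (p * (p - 1) / 2 * q / a)) ^ (2 / p) := by
            gcongr
            apply one_add_mul_self_le_rpow_one_add
            · have : 0 ≤ p * (p - 1) / 2 * q / a := by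
                have : 0 < p - 1 := by linarith
                positivity
              linarith
            · rw [le_div_iff₀ hp0]; linarith
        _ = (a + p * (p - 1) / 2 * q) ^ (2 / p) := by
            have : 0 < p - 1 := by linarith
            rw [← Real.mul_rpow h.le (by positivity)]
            congr 1; field_simp
        _ ≤ s ^ (2 / p) := by
            have : 0 < p - 1 := by linarith
            exact Real.rpow_le_rpow (by positivity) hs (by positivity)
    have : (p - 1) * b ^ (2 / p) ≤ (p - 1) * (q * (a ^ (2 / p) / a)) := by
      gcongr
    have e : a ^ (2 / p) * (1 + (p - 1) * (q / a)) = a ^ (2 / p) + (p - 1) * (q * (a ^ (2 / p) / a)) := by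
      field_simp
    linarith

theorem bcl {p : ℝ} (hp1 : 1 < p) (hp2 : p < 2) {A B : Matrix ι ι ℂ}
    (hU : (A + B).PosSemidef) (hV : (A - B).PosSemidef) :
    Sp p A ^ (2 / p) + (p - 1) * Sp p B ^ (2 / p) ≤ ((Sp p (A + B) + Sp p (A - B)) / 2) ^ (2 / p) := by
  have hA := psd_avg hU hV
  have hB : B.IsHermitian := by
    have := hU.1.sub hA.1
    simpa using this
  obtain ⟨W, b, hW, e⟩ := spec_herm hB
  have hW' : W * Wᴴ = 1 := mul_eq_one_comm.1 hW
  have hWW : Wᴴᴴ * Wᴴ = 1 := by rw [conjTranspose_conjTranspose, hW']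
  set A' := Wᴴ * A * Wᴴᴴ with hA'
  have eB : Wᴴ * B * Wᴴᴴ = diagonal (fun i => (b i : ℂ)) := by
    rw [e, conjTranspose_conjTranspose]
    calc _ = (Wᴴ * W) * diagonal (fun i => (b i : ℂ)) * (Wᴴ * W) := by simp only [mul_assoc]
      _ = _ := by rw [hW, one_mul, mul_one]
  have eU : Wᴴ * (A + B) * Wᴴᴴ = A' + diagonal (fun i => (b i : ℂ)) := by
    rw [mul_add, add_mul, eB]
  have eV : Wᴴ * (A - B) * Wᴴᴴ = A' - diagonal (fun i => (b i : ℂ)) := by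
    rw [mul_sub, sub_mul, eB]
  have hU' := hU.mul_mul_conjTranspose_same Wᴴ
  have hV' := hV.mul_mul_conjTranspose_same Wᴴ
  rw [eU] at hU'
  rw [eV] at hV'
  have key := bcl_diag hp1 hp2 b hU' hV'
  have hA1 := psd_avg hU' hV'
  have d1 := diag_sum_le hp1 hA1
  have sB : Sp p B = ∑ i, |b i| ^ p := by rw [e, Sp_svd p W W b hW hW]
  have sA : Sp p A' = Sp p A := by rw [hA', Sp_conj p _ _ hWW]
  have sU := Sp_conj p Wᴴ (A + B) hWW
  have sV := Sp_conj p Wᴴ (A - B) hWW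
  rw [eU] at sU
  rw [eV] at sV
  rw [sA, sU, sV] at key
  rw [sA] at d1
  have h1 : ∀ i, 0 ≤ (A' i i).re + b i := fun i => by
    simpa using (Complex.le_def.1 (hU'.diag_nonneg (i := i))).1
  have h2 : ∀ i, 0 ≤ (A' i i).re - b i := fun i => by
    simpa using (Complex.le_def.1 (hV'.diag_nonneg (i := i))).1
  have hm : ∀ i, 0 ≤ (A' i i).re := fun i => by linarith [h1 i, h2 i]
  have hh := holder_aux hp1 hp2 b (fun i => (A' i i).re) hm (fun i h => by linarith [h1 i, h2 i])
  have hq : 0 ≤ ∑ i, b i ^ 2 * (A' i i).re ^ (p - 2) :=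
    Finset.sum_nonneg fun i _ => by have := hm i; positivity
  refine scal_final hp1 hp2 (Sp_nonneg p A) hq (Sp_nonneg p B)
    (by have := Sp_nonneg p (A+B); have := Sp_nonneg p (A-B); positivity) ?_ ?_
  · rw [sB]
    refine hh.trans ?_
    gcongr
    · exact Finset.sum_nonneg fun i _ => by have := hm i; positivity
  · linarith
end
end MC

namespace MC
section
variable {ι κ : Type*} [Fintype ι] [DecidableEq ι] [Fintype κ]

theorem svd (T : Matrix ι ι ℂ) : ∃ (U V : Matrix ι ι ℂ) (d : ι → ℝ), Uᴴ * U = 1 ∧ Vᴴ * V = 1 ∧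
    (∀ i, 0 ≤ d i) ∧ T = U * diagonal (fun i => (d i : ℂ)) * Vᴴ := by
  obtain ⟨V, l, hV, hl, e⟩ := spec_psd (posSemidef_conjTranspose_mul_self T)
  have hV' : V * Vᴴ = 1 := mul_eq_one_comm.1 hV
  have hF : (T * V)ᴴ * (T * V) = diagonal (fun i => (l i : ℂ)) := by
    rw [conjTranspose_mul]
    calc _ = Vᴴ * (Tᴴ * T) * V := by simp only [mul_assoc]
      _ = (Vᴴ * V) * diagonal (fun i => (l i : ℂ)) * (Vᴴ * V) := by rw [e]; simp only [mul_assoc]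
      _ = _ := by rw [hV, one_mul, mul_one]
  set F := T * V with hFdef
  have hFij : ∀ i j, ∑ k, star (F k i) * F k j = if i = j then (l i : ℂ) else 0 := by
    intro i j
    have := congrFun (congrFun hF i) j
    simpa [mul_apply, diagonal_apply] using this
  let v : ι → EuclideanSpace ℂ ι := fun i => WithLp.toLp 2 fun k => F k i / (√(l i) : ℂ)
  let s : Set ι := {i | l i ≠ 0}
  have hv : Orthonormal ℂ (s.domRestrict v) := by
    rw [orthonormal_iff_ite]
    rintro ⟨i, hi⟩ ⟨j, hj⟩
    have hi' : 0 < l i := lt_of_le_of_ne (hl i) (Ne.symm hi)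
    have hj' : 0 < l j := lt_of_le_of_ne (hl j) (Ne.symm hj)
    have h1 : inner ℂ (v i) (v j) = (∑ k, star (F k i) * F k j) / ((√(l i) : ℂ) * (√(l j) : ℂ)) := by
      rw [PiLp.inner_apply, Finset.sum_div]
      refine Finset.sum_congr rfl fun k _ => ?_
      simp [v]
      ring
    simp only [Subtype.mk.injEq]; change inner ℂ (v i) (v j) = _
    rw [h1, hFij]
    by_cases hij : i = j
    · subst hij
      simp only [if_true]
      rw [← Complex.ofReal_mul, Real.mul_self_sqrt hi'.le, div_self]
      exact_mod_cast hi
    · simp [hij]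
  obtain ⟨b, hb⟩ := hv.exists_orthonormalBasis_extension_of_card_eq (by simp)
  refine ⟨Matrix.of fun k i => b i k, V, fun i => √(l i), ?_, hV, fun i => Real.sqrt_nonneg _, ?_⟩
  · ext i j
    have := (orthonormal_iff_ite.1 b.orthonormal) i j
    rw [PiLp.inner_apply] at this
    simp only [mul_apply, conjTranspose_apply, of_apply, one_apply]
    rw [← this]
    refine Finset.sum_congr rfl fun k _ => ?_
    simp [mul_comm]
  · have : F = (Matrix.of fun k i => b i k) * diagonal (fun i => ((√(l i) : ℝ) : ℂ)) := by
      ext k i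
      rw [mul_diagonal, of_apply]
      by_cases hi : l i = 0
      · rw [hi]
        have h0 := hFij i i
        simp only [if_true, hi] at h0
        have h1 : ∑ k, Complex.normSq (F k i) = 0 := by
          have h2 := congrArg Complex.re h0
          simpa [Complex.re_sum, Complex.normSq_apply] using h2
        have h3 := (Finset.sum_eq_zero_iff_of_nonneg (fun k _ => Complex.normSq_nonneg _)).1 h1 k
          (Finset.mem_univ _)
        simp [Complex.normSq_eq_zero.1 h3]
      · rw [hb i hi]
        have hi' : 0 < l i := lt_of_le_of_ne (hl i) (Ne.symm hi)
        have : (√(l i) : ℂ) ≠ 0 := by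
          exact_mod_cast (Real.sqrt_pos.2 hi').ne'
        simp only [v]
        field_simp
    rw [← this, hFdef, mul_assoc, hV', mul_one]

theorem Sp_reindex (p : ℝ) (e : ι ≃ κ) [DecidableEq κ] (T : Matrix ι ι ℂ) :
    Sp p (reindex e e T) = Sp p T := by
  unfold Sp trf
  have : (reindex e e T)ᴴ * reindex e e T = reindex e e (Tᴴ * T) := by
    simp [conjTranspose_submatrix, submatrix_mul_equiv]
  rw [this, charpoly_reindex]

theorem Sp_fromBlocks_diag (p : ℝ) (X Z : Matrix ι ι ℂ) :
    Sp p (fromBlocks X 0 0 Z) = Sp p X + Sp p Z := by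
  unfold Sp trf
  have : (fromBlocks X 0 0 Z)ᴴ * fromBlocks X 0 0 Z = fromBlocks (Xᴴ * X) 0 0 (Zᴴ * Z) := by
    rw [fromBlocks_conjTranspose, fromBlocks_multiply]; simp
  rw [this, charpoly_fromBlocks_zero₂₁, Polynomial.roots_mul, Multiset.map_add, Multiset.sum_add]
  exact mul_ne_zero (charpoly_monic _).ne_zero (charpoly_monic _).ne_zero

theorem Sp_fromBlocks_off (p : ℝ) (Y : Matrix ι ι ℂ) :
    Sp p (fromBlocks 0 Y Yᴴ 0) = 2 * Sp p Y := by
  have h : Sp p Y + Sp p Y = 2 * Sp p Y := by ring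
  rw [← h]
  unfold Sp trf
  have : (fromBlocks 0 Y Yᴴ 0)ᴴ * fromBlocks 0 Y Yᴴ 0 = fromBlocks (Y * Yᴴ) 0 0 (Yᴴ * Y) := by
    rw [fromBlocks_conjTranspose, fromBlocks_multiply]; simp
  rw [this, charpoly_fromBlocks_zero₂₁, Polynomial.roots_mul, Multiset.map_add, Multiset.sum_add,
    charpoly_mul_comm]
  exact mul_ne_zero (charpoly_monic _).ne_zero (charpoly_monic _).ne_zero

theorem Sp_smul (p : ℝ) (c : ℝ) (hc : 0 ≤ c) (T : Matrix ι ι ℂ) :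
    Sp p ((c : ℂ) • T) = c ^ p * Sp p T := by
  obtain ⟨U, V, d, hU, hV, hd, e⟩ := svd T
  have : (c : ℂ) • T = U * diagonal (fun i => ((c * d i : ℝ) : ℂ)) * Vᴴ := by
    rw [e]
    have : diagonal (fun i => ((c * d i : ℝ) : ℂ)) = (c : ℂ) • diagonal (fun i => (d i : ℂ)) := by
      ext i j; simp [diagonal_apply]
    rw [this]; simp
  rw [this, Sp_svd p U V _ hU hV, e, Sp_svd p U V _ hU hV, Finset.mul_sum]
  refine Finset.sum_congr rfl fun i _ => ?_
  rw [abs_mul, Real.mul_rpow (abs_nonneg _) (abs_nonneg _), abs_of_nonneg hc]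

theorem bcl_block {p : ℝ} (hp1 : 1 < p) (hp2 : p < 2) {X Y Z : Matrix ι ι ℂ}
    (h : (fromBlocks X Y Yᴴ Z).PosSemidef) :
    (Sp p X + Sp p Z) ^ (2 / p) + (p - 1) * (2 * Sp p Y) ^ (2 / p) ≤
      Sp p (fromBlocks X Y Yᴴ Z) ^ (2 / p) := by
  let J : Matrix (ι ⊕ ι) (ι ⊕ ι) ℂ := fromBlocks 1 0 0 (-1)
  have hJ : Jᴴ * J = 1 := by
    simp [J, fromBlocks_conjTranspose, fromBlocks_multiply]
  have e1 : fromBlocks X Y Yᴴ Z = fromBlocks X 0 0 Z + fromBlocks 0 Y Yᴴ 0 := by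
    rw [fromBlocks_add]; simp
  have e2 : J * fromBlocks X Y Yᴴ Z * Jᴴ = fromBlocks X 0 0 Z - fromBlocks 0 Y Yᴴ 0 := by
    rw [sub_eq_add_neg, fromBlocks_neg, fromBlocks_add]
    simp [J, fromBlocks_conjTranspose, fromBlocks_multiply]
  have hV := h.mul_mul_conjTranspose_same J
  have hS := Sp_conj p J (fromBlocks X Y Yᴴ Z) hJ
  rw [e2] at hV hS
  have hU := h
  rw [e1] at hU
  have := bcl hp1 hp2 hU hV
  rw [hS, ← e1, Sp_fromBlocks_diag, Sp_fromBlocks_off] at this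
  convert this using 2
  ring

end
end MC

namespace MC
section
variable {n : ℕ}

theorem fc_eq (T : QM n) (s : Fin n → Fin 4) :
    QM.fc T s = (∑ x, ∑ y, star (QM.sigma s x y) * T x y) / 2 ^ n := by
  unfold QM.fc QM.qtr
  rw [Finset.sum_comm]
  simp [trace, mul_apply]

def blk (T : QM (n + 1)) (c d : Fin 2) : QM n :=
  Matrix.of fun x y => T (Fin.cons c x) (Fin.cons d y)

theorem sum_cons {α M : Type*} [Fintype α] [AddCommMonoid M] (f : (Fin (n + 1) → α) → M) :
    ∑ x, f x = ∑ a : α, ∑ x : Fin n → α, f (Fin.cons a x) := by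
  rw [← Fintype.sum_prod_type', ← (Fin.consEquiv (fun _ : Fin (n + 1) => α)).sum_comp]
  rfl

theorem fc_add (A B : QM n) (s) : QM.fc (A + B) s = QM.fc A s + QM.fc B s := by
  simp [fc_eq, mul_add, Finset.sum_add_distrib, add_div]

theorem fc_smul (c : ℂ) (A : QM n) (s) : QM.fc (c • A) s = c * QM.fc A s := by
  simp only [fc_eq, Matrix.smul_apply, smul_eq_mul, mul_div_assoc', Finset.mul_sum]
  congr 1
  refine Finset.sum_congr rfl fun x _ => Finset.sum_congr rfl fun y _ => ?_
  ring

theorem fc_cons (T : QM (n + 1)) (a : Fin 4) (s : Fin n → Fin 4) :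
    QM.fc T (Fin.cons a s) =
      (∑ c, ∑ d, star (QM.pauli a c d) * QM.fc (blk T c d) s) / 2 := by
  have h : ∀ c d x y, star (QM.sigma (Fin.cons a s : Fin (n + 1) → Fin 4) (Fin.cons c x) (Fin.cons d y))
      = star (QM.pauli a c d) * star (QM.sigma s x y) := by
    intro c d x y
    simp only [QM.sigma, of_apply, Fin.prod_univ_succ, Fin.cons_zero, Fin.cons_succ, star_mul']
  rw [fc_eq, sum_cons]
  have h1 : ∀ c d, star (QM.pauli a c d) * QM.fc (blk T c d) s =
      (∑ x, ∑ y, star (QM.pauli a c d) * star (QM.sigma s x y) * T (Fin.cons c x) (Fin.cons d y))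
        / 2 ^ n := by
    intro c d
    rw [fc_eq, mul_div_assoc', Finset.mul_sum]
    congr 1
    refine Finset.sum_congr rfl fun x _ => ?_
    rw [Finset.mul_sum]
    refine Finset.sum_congr rfl fun y _ => ?_
    simp only [blk, of_apply, mul_assoc]
  simp only [h1, ← Finset.sum_div]
  rw [div_div, pow_succ]
  congr 1
  refine Finset.sum_congr rfl fun c _ => ?_
  conv_rhs => rw [Finset.sum_comm]
  refine Finset.sum_congr rfl fun x _ => ?_
  rw [sum_cons]
  refine Finset.sum_congr rfl fun d _ => ?_
  refine Finset.sum_congr rfl fun y _ => ?_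
  rw [h]

def q (ρ : ℝ) (A B : QM n) : ℂ :=
  ∑ s : Fin n → Fin 4, (ρ : ℂ) ^ (QM.supp s).card * (star (QM.fc A s) * QM.fc B s)

def Q (ρ : ℝ) (A : QM n) : ℝ :=
  ∑ s : Fin n → Fin 4, ρ ^ (QM.supp s).card * ‖QM.fc A s‖ ^ 2

theorem q_self (ρ : ℝ) (A : QM n) : q ρ A A = (Q ρ A : ℂ) := by
  unfold q Q
  push_cast
  refine Finset.sum_congr rfl fun s _ => ?_
  congr 1
  rw [Complex.star_def, Complex.conj_mul']

theorem supp_cons (a : Fin 4) (s : Fin n → Fin 4) :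
    (QM.supp (Fin.cons a s : Fin (n + 1) → Fin 4)).card =
      (if a = 0 then 0 else 1) + (QM.supp s).card := by
  unfold QM.supp
  simp only [Finset.card_filter, Fin.sum_univ_succ, Fin.cons_zero, Fin.cons_succ]
  congr 1
  by_cases h : a = 0 <;> simp [h]

theorem q_rec (ρ : ℝ) (A B : QM (n + 1)) :
    q ρ A B = (1 - (ρ : ℂ)) * q ρ ((1 / 2 : ℂ) • (blk A 0 0 + blk A 1 1))
        ((1 / 2 : ℂ) • (blk B 0 0 + blk B 1 1)) +
      (ρ : ℂ) / 2 * ∑ c, ∑ d, q ρ (blk A c d) (blk B c d) := by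
  unfold q
  rw [sum_cons, Finset.sum_comm]
  simp only [Fin.sum_univ_two]
  simp only [Finset.mul_sum, ← Finset.sum_add_distrib]
  refine Finset.sum_congr rfl fun s _ => ?_
  simp only [Fin.sum_univ_four, supp_cons, fc_cons, fc_smul, fc_add, Fin.sum_univ_two]
  have I2 : Complex.I ^ 2 = -1 := Complex.I_sq
  simp [QM.pauli, pow_add]
  ring_nf
  simp only [I2]
  ring

theorem sigma_herm (s : Fin n → Fin 4) (x y) : star (QM.sigma s x y) = QM.sigma s y x := by
  simp only [QM.sigma, of_apply, star_prod]
  refine Finset.prod_congr rfl fun j _ => ?_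
  generalize s j = a
  generalize x j = c
  generalize y j = d
  fin_cases a <;> fin_cases c <;> fin_cases d <;> simp [QM.pauli]

theorem fc_conj (A : QM n) (s) : QM.fc Aᴴ s = star (QM.fc A s) := by
  rw [fc_eq, fc_eq, star_div₀, star_sum]
  simp only [star_sum, star_mul', star_star, conjTranspose_apply]
  rw [Finset.sum_comm]
  congr 1
  · refine Finset.sum_congr rfl fun x _ => Finset.sum_congr rfl fun y _ => ?_
    rw [sigma_herm]
  · simp

theorem Q_conj (ρ : ℝ) (A : QM n) : Q ρ Aᴴ = Q ρ A := by
  unfold Q; simp only [fc_conj, norm_star]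

theorem Q_par (ρ : ℝ) (A B : QM n) :
    Q ρ A + Q ρ B = 2 * Q ρ ((1 / 2 : ℂ) • (A + B)) + 2 * Q ρ ((1 / 2 : ℂ) • (A - B)) := by
  unfold Q
  have : A - B = A + (-1 : ℂ) • B := by simp [sub_eq_add_neg]
  rw [this]
  simp only [Finset.mul_sum, ← Finset.sum_add_distrib, fc_smul, fc_add]
  refine Finset.sum_congr rfl fun s _ => ?_
  generalize QM.fc A s = a
  generalize QM.fc B s = b
  simp only [← Complex.normSq_eq_norm_sq, Complex.normSq_apply]
  simp
  ring

theorem q_neg (ρ : ℝ) (A B : QM n) : q ρ A (-B) = - q ρ A B := by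
  have : -B = (-1 : ℂ) • B := by simp
  unfold q
  rw [this]
  simp only [fc_smul]
  simp

theorem Q_rec (ρ : ℝ) (T : QM (n + 1)) (Y : QM n) (h1 : blk T 0 1 = Y) (h2 : blk T 1 0 = Yᴴ) :
    Q ρ T = Q ρ ((1 / 2 : ℂ) • (blk T 0 0 + blk T 1 1)) +
      ρ * Q ρ ((1 / 2 : ℂ) • (blk T 0 0 - blk T 1 1)) + ρ * Q ρ Y := by
  have h := q_rec ρ T T
  have hp := Q_par ρ (blk T 0 0) (blk T 1 1)
  simp only [q_self, Fin.sum_univ_two, h1, h2, Q_conj] at h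
  have h' : Q ρ T = (1 - ρ) * Q ρ ((1 / 2 : ℂ) • (blk T 0 0 + blk T 1 1)) +
      ρ / 2 * (Q ρ (blk T 0 0) + Q ρ Y + (Q ρ Y + Q ρ (blk T 1 1))) := by
    exact_mod_cast h
  rw [h']
  linear_combination ρ / 2 * hp

theorem trace_psd_mul {ι : Type*} [Fintype ι] [DecidableEq ι] {G H : Matrix ι ι ℂ}
    (hG : G.PosSemidef) (hH : H.PosSemidef) : 0 ≤ trace (G * H) := by
  obtain ⟨U, d, hU, hd, e⟩ := spec_psd hG
  have h1 : trace (G * H) = trace (diagonal (fun i => (d i : ℂ)) * (Uᴴ * H * U)) := by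
    rw [e, mul_assoc, mul_assoc, trace_mul_comm]
    simp only [mul_assoc]
  rw [h1]
  have h2 := hH.conjTranspose_mul_mul_same U
  simp only [trace, diag_apply, diagonal_mul]
  refine Finset.sum_nonneg fun i _ => mul_nonneg ?_ h2.diag_nonneg
  exact_mod_cast hd i

def sub {ι : Type*} (G : Matrix (ι × (Fin n → Fin 2)) (ι × (Fin n → Fin 2)) ℂ) (a b : ι) : QM n :=
  Matrix.of fun x y => G (a, x) (b, y)

theorem q_zero (ρ : ℝ) (A B : QM 0) (z : Fin 0 → Fin 2) : q ρ A B = star (A z z) * B z z := by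
  have hz : ∀ w : Fin 0 → Fin 2, w = z := fun w => Subsingleton.elim _ _
  unfold q
  simp [fc_eq, QM.sigma, QM.supp]
  rw [hz (@default _ Unique.instInhabited)]

theorem q_pos (ρ : ℝ) (h0 : 0 ≤ ρ) (h1 : ρ ≤ 1) : ∀ (n : ℕ) (ι : Type) [Fintype ι] [DecidableEq ι]
    (G H : Matrix (ι × (Fin n → Fin 2)) (ι × (Fin n → Fin 2)) ℂ),
    G.PosSemidef → H.PosSemidef → 0 ≤ ∑ a, ∑ b, q ρ (sub G a b) (sub H a b) := by
  intro n
  induction n with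
  | zero =>
    intro ι _ _ G H hG hH
    have h := trace_psd_mul hG hH
    have e : trace (G * H) = ∑ a, ∑ b, q ρ (sub G a b) (sub H a b) := by
      simp only [q_zero ρ _ _ (@default _ Unique.instInhabited), sub, of_apply, trace, diag_apply, mul_apply, Fintype.sum_prod_type,
        Finset.univ_unique, Finset.sum_singleton]
      rw [Finset.sum_comm]
      refine Finset.sum_congr rfl fun a _ => Finset.sum_congr rfl fun b _ => ?_
      congr 1
      exact (hG.1.apply (b, _) (a, _)).symm
    rwa [← e]
  | succ n ih =>
    intro ι _ _ G H hG hH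
    let g : (ι × Fin 2) × (Fin n → Fin 2) → ι × (Fin (n + 1) → Fin 2) := fun z =>
      (z.1.1, Fin.cons z.1.2 z.2)
    let f : Fin 2 → ι × (Fin n → Fin 2) → ι × (Fin (n + 1) → Fin 2) := fun c z =>
      (z.1, Fin.cons c z.2)
    have p1 := ih (ι × Fin 2) (G.submatrix g g) (H.submatrix g g) (hG.submatrix g) (hH.submatrix g)
    have half : (0 : ℂ) ≤ 1 / 2 := by
      rw [Complex.le_def]; norm_num
    have p2 := ih ι ((1 / 2 : ℂ) • (G.submatrix (f 0) (f 0) + G.submatrix (f 1) (f 1)))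
      ((1 / 2 : ℂ) • (H.submatrix (f 0) (f 0) + H.submatrix (f 1) (f 1)))
      (((hG.submatrix _).add (hG.submatrix _)).smul half)
      (((hH.submatrix _).add (hH.submatrix _)).smul half)
    have e : ∑ a, ∑ b, q ρ (sub G a b) (sub H a b) =
      (1 - (ρ : ℂ)) * ∑ a, ∑ b, q ρ
        (sub ((1 / 2 : ℂ) • (G.submatrix (f 0) (f 0) + G.submatrix (f 1) (f 1))) a b)
        (sub ((1 / 2 : ℂ) • (H.submatrix (f 0) (f 0) + H.submatrix (f 1) (f 1))) a b) +
      (ρ : ℂ) / 2 * ∑ a, ∑ b, q ρ (sub (G.submatrix g g) a b) (sub (H.submatrix g g) a b) := by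
      simp only [Fintype.sum_prod_type, Finset.mul_sum, ← Finset.sum_add_distrib]
      refine Finset.sum_congr rfl fun a _ => ?_
      have hr : ∀ b, q ρ (sub G a b) (sub H a b) = _ := fun b => q_rec ρ (sub G a b) (sub H a b)
      simp only [hr, Finset.sum_add_distrib, Finset.mul_sum]
      congr 1
      rw [Finset.sum_comm]
      refine Finset.sum_congr rfl fun c _ => ?_
      rfl
    rw [e]
    refine add_nonneg (mul_nonneg ?_ p2) (mul_nonneg ?_ p1)
    · have : (0 : ℂ) ≤ ((1 - ρ : ℝ) : ℂ) := by exact_mod_cast sub_nonneg.2 h1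
      simpa using this
    · have : (0 : ℂ) ≤ ((ρ / 2 : ℝ) : ℂ) := by exact_mod_cast (by positivity)
      simpa using this

theorem Q_avg (ρ : ℝ) (h0 : 0 ≤ ρ) (h1 : ρ ≤ 1) (U V : QM n) (d : (Fin n → Fin 2) → ℝ)
    (hd : ∀ i, 0 ≤ d i) :
    Q ρ (U * diagonal (fun i => (d i : ℂ)) * Vᴴ) ≤
      (Q ρ (U * diagonal (fun i => (d i : ℂ)) * Uᴴ) +
        Q ρ (V * diagonal (fun i => (d i : ℂ)) * Vᴴ)) / 2 := by
  set D : QM n := diagonal (fun i => (d i : ℂ)) with hD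
  have hDp : D.PosSemidef := by
    rw [hD, posSemidef_diagonal_iff]
    intro i
    exact_mod_cast hd i
  let F : QM n → Matrix (Fin 2 × (Fin n → Fin 2)) (Fin n → Fin 2) ℂ := fun W =>
    Matrix.of fun a i => (![U, W] a.1) a.2 i
  have h := q_pos ρ h0 h1 n (Fin 2) (F V * D * (F V)ᴴ) (F (-V) * D * (F (-V))ᴴ)
    (hDp.mul_mul_conjTranspose_same _) (hDp.mul_mul_conjTranspose_same _)
  have g : ∀ W a b, sub (F W * D * (F W)ᴴ) a b = (![U, W] a) * D * (![U, W] b)ᴴ := by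
    intro W a b
    rfl
  have hT : (U * D * Vᴴ)ᴴ = V * D * Uᴴ := by
    rw [conjTranspose_mul, conjTranspose_mul, conjTranspose_conjTranspose, hDp.1.eq, mul_assoc]
  simp only [g, Fin.sum_univ_two, cons_val_zero, cons_val_one, conjTranspose_neg, neg_mul, mul_neg,
    neg_neg, q_neg, q_self] at h
  rw [← hT, Q_conj] at h
  have h' : 0 ≤ Q ρ (U * D * Uᴴ) + -Q ρ (U * D * Vᴴ) +
     (-Q ρ (U * D * Vᴴ) + Q ρ (V * D * Vᴴ)) := by exact_mod_cast h
  linarith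
end
end MC

namespace MC
section
variable {n : ℕ}

def blkEquiv (n : ℕ) : (Fin n → Fin 2) ⊕ (Fin n → Fin 2) ≃ (Fin (n + 1) → Fin 2) :=
  Equiv.ofBijective (Sum.elim (fun x => (Fin.cons 0 x : Fin (n + 1) → Fin 2))
      (fun x => (Fin.cons 1 x : Fin (n + 1) → Fin 2))) (by
    constructor
    · rintro (x | x) (y | y) h
      · simpa using h
      · have := congrFun h 0
        simp at this
      · have := congrFun h 0
        simp at this
      · simpa using h
    · intro z
      have h2 : z 0 = 0 ∨ z 0 = 1 := by
        generalize z 0 = a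
        fin_cases a <;> simp
      rcases h2 with h | h
      · refine ⟨Sum.inl (Fin.tail z), ?_⟩
        simp only [Sum.elim_inl]
        rw [← h, Fin.cons_self_tail]
      · refine ⟨Sum.inr (Fin.tail z), ?_⟩
        simp only [Sum.elim_inr]
        rw [← h, Fin.cons_self_tail])

theorem blk_eq (T : QM (n + 1)) : T.submatrix (blkEquiv n) (blkEquiv n) =
    fromBlocks (blk T 0 0) (blk T 0 1) (blk T 1 0) (blk T 1 1) := by
  ext (x | x) (y | y) <;> rfl

theorem Sp_blk (p : ℝ) (T : QM (n + 1)) :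
    Sp p (fromBlocks (blk T 0 0) (blk T 0 1) (blk T 1 0) (blk T 1 1)) = Sp p T := by
  rw [← blk_eq, ← Sp_reindex p (blkEquiv n).symm T]
  rfl

theorem scal_step {p N a b y x z t qa qb qy : ℝ} (hp0 : 0 < p) (hρ : 0 < p - 1) (hN : 0 < N)
    (n1 : 0 ≤ a) (n2 : 0 ≤ b) (n3 : 0 ≤ y) (n4 : 0 ≤ x) (n5 : 0 ≤ z) (n6 : 0 ≤ t)
    (i1 : qa ≤ (a / N) ^ (2 / p)) (i2 : qb ≤ (b / N) ^ (2 / p)) (i3 : qy ≤ (y / N) ^ (2 / p))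
    (hb2 : a ^ (2 / p) + (p - 1) * b ^ (2 / p) ≤ ((x + z) / 2) ^ (2 / p))
    (hb : (x + z) ^ (2 / p) + (p - 1) * (2 * y) ^ (2 / p) ≤ t ^ (2 / p)) :
    qa + (p - 1) * qb + (p - 1) * qy ≤ (t / (N * 2)) ^ (2 / p) := by
  rw [Real.div_rpow n6 (by positivity), Real.mul_rpow hN.le (by norm_num)]
  rw [Real.div_rpow n1 hN.le] at i1
  rw [Real.div_rpow n2 hN.le] at i2
  rw [Real.div_rpow n3 hN.le] at i3
  rw [Real.div_rpow (by positivity) (by norm_num)] at hb2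
  rw [Real.mul_rpow (by norm_num) n3] at hb
  have hM : (0 : ℝ) < N ^ (2 / p) := by positivity
  have hc : (0 : ℝ) < (2 : ℝ) ^ (2 / p) := by positivity
  generalize N ^ (2 / p) = M at *
  generalize (2 : ℝ) ^ (2 / p) = c at *
  generalize p - 1 = ρ at *
  rw [le_div_iff₀ hM] at i1 i2 i3
  rw [le_div_iff₀ hc] at hb2
  rw [le_div_iff₀ (by positivity)]
  have j2 := mul_le_mul_of_nonneg_left i2 hρ.le
  have j3 := mul_le_mul_of_nonneg_left i3 hρ.le
  have j := mul_le_mul_of_nonneg_right (add_le_add (add_le_add i1 j2) j3) hc.le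
  linarith [j, hb2, hb]

theorem H_psd_step {p : ℝ} (hp1 : 1 < p) (hp2 : p < 2)
    (ih : ∀ T : QM n, Q (p - 1) T ≤ (Sp p T / 2 ^ n) ^ (2 / p)) (T : QM (n + 1))
    (hT : T.PosSemidef) : Q (p - 1) T ≤ (Sp p T / 2 ^ (n + 1)) ^ (2 / p) := by
  have h10 : blk T 1 0 = (blk T 0 1)ᴴ := by
    ext x y
    exact (hT.1.apply _ _).symm
  have hsp := Sp_blk p T
  have hps : (fromBlocks (blk T 0 0) (blk T 0 1) (blk T 1 0) (blk T 1 1)).PosSemidef := by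
    rw [← blk_eq]; exact hT.submatrix _
  rw [h10] at hsp hps
  rw [Q_rec (p - 1) T _ rfl h10]
  have hX : (blk T 0 0).PosSemidef := hT.submatrix (fun x => Fin.cons 0 x)
  have hZ : (blk T 1 1).PosSemidef := hT.submatrix (fun x => Fin.cons 1 x)
  have hb := bcl_block hp1 hp2 hps
  rw [hsp] at hb
  generalize blk T 0 0 = X at *
  generalize blk T 0 1 = Y at *
  generalize blk T 1 1 = Z at *
  have eX : (1 / 2 : ℂ) • (X + Z) + (1 / 2 : ℂ) • (X - Z) = X := by module
  have eZ : (1 / 2 : ℂ) • (X + Z) - (1 / 2 : ℂ) • (X - Z) = Z := by module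
  have hb2 := bcl (A := (1 / 2 : ℂ) • (X + Z)) (B := (1 / 2 : ℂ) • (X - Z)) hp1 hp2
    (by rwa [eX]) (by rwa [eZ])
  rw [eX, eZ] at hb2
  have i1 := ih ((1 / 2 : ℂ) • (X + Z))
  have i2 := ih ((1 / 2 : ℂ) • (X - Z))
  have i3 := ih Y
  have n1 := Sp_nonneg p ((1 / 2 : ℂ) • (X + Z))
  have n2 := Sp_nonneg p ((1 / 2 : ℂ) • (X - Z))
  have n3 := Sp_nonneg p Y
  have n4 := Sp_nonneg p X
  have n5 := Sp_nonneg p Z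
  have n6 := Sp_nonneg p T
  rw [pow_succ]
  exact scal_step (N := 2 ^ n) (by linarith) (by linarith) (by positivity) n1 n2 n3 n4 n5 n6 i1 i2 i3 hb2 hb

theorem H_main {p : ℝ} (hp1 : 1 < p) (hp2 : p < 2) : ∀ (n : ℕ) (T : QM n),
    Q (p - 1) T ≤ (Sp p T / 2 ^ n) ^ (2 / p) := by
  have hp0 : 0 < p := by linarith
  have gen : ∀ n, (∀ T : QM n, T.PosSemidef → Q (p - 1) T ≤ (Sp p T / 2 ^ n) ^ (2 / p)) →
      ∀ (T : QM n), Q (p - 1) T ≤ (Sp p T / 2 ^ n) ^ (2 / p) := by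
    intro n h T
    obtain ⟨U, V, d, hU, hV, hd, e⟩ := svd T
    have hDp : (diagonal (fun i => (d i : ℂ))).PosSemidef := by
      rw [posSemidef_diagonal_iff]
      intro i
      exact_mod_cast hd i
    have ha := Q_avg (p - 1) (by linarith) (by linarith) U V d hd
    have h1 := h _ (hDp.mul_mul_conjTranspose_same U)
    have h2 := h _ (hDp.mul_mul_conjTranspose_same V)
    rw [Sp_svd p _ _ _ hU hU] at h1
    rw [Sp_svd p _ _ _ hV hV] at h2
    rw [e, Sp_svd p _ _ _ hU hV]
    linarith
  intro n
  induction n with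
  | zero =>
    intro T
    apply le_of_eq
    have h := q_self (p - 1) T
    rw [q_zero _ _ _ default] at h
    have hS : Sp p T = ‖T default default‖ ^ p := by
      unfold Sp
      rw [trf_of_charpoly (κ := Fin 0 → Fin 2) _ _ (fun _ => ‖T default default‖ ^ 2)]
      · simp
      · rw [charpoly, det_unique, Finset.univ_unique, Finset.prod_singleton, charmatrix_apply_eq]
        congr 2
        rw [mul_apply, Finset.univ_unique, Finset.sum_singleton, conjTranspose_apply,
          Subsingleton.elim (@default (Fin 0 → Fin 2) Unique.instInhabited) default,
          Complex.star_def, Complex.conj_mul']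
        push_cast; rfl
    have hQ : Q (p - 1) T = ‖T default default‖ ^ 2 := by
      have : ((Q (p - 1) T : ℝ) : ℂ) = ((‖T default default‖ ^ 2 : ℝ) : ℂ) := by
        rw [← h, Complex.star_def, Complex.conj_mul']; push_cast; rfl
      exact_mod_cast this
    rw [hQ, hS, pow_zero, div_one, ← Real.rpow_mul (norm_nonneg _), mul_div_cancel₀ _ hp0.ne']
    norm_num
  | succ n ih => exact gen _ (H_psd_step hp1 hp2 ih)
end
end MC

namespace MC
section
variable {n : ℕ}

theorem snorm_eq (p : ℝ) (T : QM n) : QM.snorm p T = (Sp p T / 2 ^ n) ^ (1 / p) := by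
  unfold QM.snorm Sp
  rw [trf_of_charpoly (κ := Fin n → Fin 2) _ _
    (fun i => (Matrix.posSemidef_conjTranspose_mul_self T).1.eigenvalues i)]
  · rfl
  · exact (Matrix.posSemidef_conjTranspose_mul_self T).1.charpoly_eq

theorem parseval : ∀ (n : ℕ) (A B : QM n), q 1 A B = trace (Aᴴ * B) / 2 ^ n := by
  intro n
  have tr : ∀ (n : ℕ) (A B : QM n), trace (Aᴴ * B) = ∑ x, ∑ y, star (A x y) * B x y := by
    intro n A B
    rw [Finset.sum_comm]
    simp [trace, mul_apply]
  induction n with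
  | zero =>
    intro A B
    rw [q_zero _ _ _ (@default _ Unique.instInhabited), tr]
    simp
  | succ n ih =>
    intro A B
    rw [q_rec]
    simp only [ih, tr]
    rw [sum_cons]
    simp only [sum_cons (fun y => star (A _ y) * B _ y)]
    have : ∀ c : Fin 2, ∑ x : Fin n → Fin 2, ∑ d : Fin 2, ∑ y : Fin n → Fin 2,
        star (A (Fin.cons c x) (Fin.cons d y)) * B (Fin.cons c x) (Fin.cons d y) =
        ∑ d : Fin 2, ∑ x, ∑ y, star (blk A c d x y) * blk B c d x y := by
      intro c
      rw [Finset.sum_comm]; rfl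
    simp only [this, ← Finset.sum_div, pow_succ]
    push_cast
    field_simp
    ring

theorem final {k : ℕ} (T : QM n)
    (hdeg : ∀ s : Fin n → Fin 4, k < (QM.supp s).card → QM.fc T s = 0)
    (r : ℝ) (hr : 2 < r) :
    QM.snorm r T ≤ (r - 1) ^ ((k : ℝ) / 2) * QM.snorm 2 T := by
  obtain ⟨U, V, d, hU, hV, hd, e⟩ := svd T
  have hr1 : 0 < r - 1 := by linarith
  set p : ℝ := r / (r - 1) with hp
  have hp1 : 1 < p := by rw [hp, lt_div_iff₀ hr1]; linarith
  have hp2 : p < 2 := by rw [hp, div_lt_iff₀ hr1]; linarith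
  have hpr : (p - 1) * (r - 1) = 1 := by rw [hp]; field_simp; ring
  have hpr2 : (r - 1) * p = r := by rw [hp]; field_simp
  set S : QM n := U * diagonal (fun i => ((d i ^ (r - 1) : ℝ) : ℂ)) * Vᴴ with hS
  have sT : Sp r T = ∑ i, d i ^ r := by
    rw [e, Sp_svd r U V d hU hV]
    exact Finset.sum_congr rfl fun i _ => by rw [abs_of_nonneg (hd i)]
  have sT2 : Sp 2 T = ∑ i, d i ^ 2 := by
    rw [e, Sp_svd 2 U V d hU hV]
    exact Finset.sum_congr rfl fun i _ => by simp
  have sS : Sp p S = ∑ i, d i ^ r := by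
    rw [hS, Sp_svd p U V _ hU hV]
    refine Finset.sum_congr rfl fun i _ => ?_
    rw [abs_of_nonneg (Real.rpow_nonneg (hd i) _), ← Real.rpow_mul (hd i), hpr2]
  have trc : ∀ f g : (Fin n → Fin 2) → ℝ, trace ((U * diagonal (fun i => (f i : ℂ)) * Vᴴ)ᴴ *
      (U * diagonal (fun i => (g i : ℂ)) * Vᴴ)) = ((∑ i, f i * g i : ℝ) : ℂ) := by
    intro f g
    rw [conjTranspose_mul, conjTranspose_mul, conjTranspose_conjTranspose, diagonal_conjTranspose]
    have : V * ((diagonal (star fun i => (f i : ℂ))) * Uᴴ) *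
      (U * diagonal (fun i => (g i : ℂ)) * Vᴴ) = V * (diagonal (star fun i => (f i : ℂ)) * (Uᴴ * U) *
        diagonal (fun i => (g i : ℂ)) * Vᴴ) := by simp only [mul_assoc]
    rw [this, hU, mul_one, trace_mul_comm, mul_assoc, hV, mul_one, diagonal_mul_diagonal,
      trace_diagonal]
    push_cast
    refine Finset.sum_congr rfl fun i _ => ?_
    simp
  have t1 : q 1 S T = (((∑ i, d i ^ r) / 2 ^ n : ℝ) : ℂ) := by
    rw [parseval, hS]
    conv_lhs => rw [e]
    rw [trc]
    push_cast
    congr 1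
    refine Finset.sum_congr rfl fun i _ => ?_
    have : d i ^ (r - 1) * d i = d i ^ r := by
      nth_rewrite 2 [← Real.rpow_one (d i)]
      rw [← Real.rpow_add' (hd i) (by linarith)]
      congr 1; ring
    exact_mod_cast this
  have t2 : Q 1 T = (∑ i, d i ^ 2) / 2 ^ n := by
    have : ((Q 1 T : ℝ) : ℂ) = (((∑ i, d i ^ 2) / 2 ^ n : ℝ) : ℂ) := by
      rw [← q_self, parseval]
      conv_lhs => rw [e]
      rw [trc]
      push_cast
      congr 1
      refine Finset.sum_congr rfl fun i _ => ?_
      ring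
    exact_mod_cast this
  set a : ℝ := (∑ i, d i ^ r) / 2 ^ n with ha
  have ha0 : 0 ≤ a := by
    have : 0 ≤ ∑ i, d i ^ r := Finset.sum_nonneg fun i _ => Real.rpow_nonneg (hd i) _
    positivity
  have hm := H_main hp1 hp2 n S
  rw [sS, ← ha] at hm
  have hb0 : 0 ≤ Q 1 T := Finset.sum_nonneg fun s _ => by positivity
  -- Cauchy-Schwarz
  have cs : a ^ 2 ≤ (r - 1) ^ k * Q 1 T * Q (p - 1) S := by
    have c1 : a ≤ ∑ s, ‖QM.fc T s‖ * ‖QM.fc S s‖ := by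
      have : ‖q 1 S T‖ = a := by rw [t1, Complex.norm_real, Real.norm_of_nonneg ha0]
      rw [← this]
      unfold q
      refine (norm_sum_le _ _).trans (Finset.sum_le_sum fun s _ => ?_)
      simp [mul_comm]
    have c2 : ∑ s, ‖QM.fc T s‖ * ‖QM.fc S s‖ =
        ∑ s, (√((r - 1) ^ (QM.supp s).card) * ‖QM.fc T s‖) *
          (√((p - 1) ^ (QM.supp s).card) * ‖QM.fc S s‖) := by
      refine Finset.sum_congr rfl fun s _ => ?_
      have : √((r - 1) ^ (QM.supp s).card) * √((p - 1) ^ (QM.supp s).card) = 1 := by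
        rw [← Real.sqrt_mul (by positivity), ← mul_pow, mul_comm (r - 1), hpr]; simp
      linear_combination (-‖QM.fc T s‖ * ‖QM.fc S s‖) * this
    have c3 := Finset.sum_mul_sq_le_sq_mul_sq Finset.univ
      (fun s : Fin n → Fin 4 => √((r - 1) ^ (QM.supp s).card) * ‖QM.fc T s‖)
      (fun s => √((p - 1) ^ (QM.supp s).card) * ‖QM.fc S s‖)
    rw [← c2] at c3
    have hp10 : 0 < p - 1 := by linarith
    have c4 : ∑ s, (√((p - 1) ^ (QM.supp s).card) * ‖QM.fc S s‖) ^ 2 = Q (p - 1) S := by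
      unfold Q
      refine Finset.sum_congr rfl fun s _ => ?_
      rw [mul_pow, Real.sq_sqrt (by positivity)]
    have c5 : ∑ s, (√((r - 1) ^ (QM.supp s).card) * ‖QM.fc T s‖) ^ 2 ≤ (r - 1) ^ k * Q 1 T := by
      unfold Q
      rw [Finset.mul_sum]
      refine Finset.sum_le_sum fun s _ => ?_
      rw [mul_pow, Real.sq_sqrt (by positivity), one_pow, one_mul]
      by_cases h : k < (QM.supp s).card
      · simp [hdeg s h]
      · refine mul_le_mul_of_nonneg_right ?_ (by positivity)
        exact pow_le_pow_right₀ (by linarith) (not_lt.1 h)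
    rw [c4] at c3
    have hQ : 0 ≤ Q (p - 1) S := Finset.sum_nonneg fun s _ => by positivity
    calc a ^ 2 ≤ _ := pow_le_pow_left₀ ha0 c1 2
      _ ≤ _ := c3
      _ ≤ _ := mul_le_mul_of_nonneg_right c5 hQ
  rw [snorm_eq, snorm_eq, sT, sT2, ← t2, ← ha]
  rcases ha0.eq_or_lt with h0 | hapos
  · rw [← h0, Real.zero_rpow (by positivity)]
    positivity
  have cs2 : a ^ 2 ≤ (r - 1) ^ k * Q 1 T * a ^ (2 / p) :=
    cs.trans (mul_le_mul_of_nonneg_left hm (by positivity))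
  have e1 : a ^ 2 = a ^ (2 / r) * a ^ (2 / p) := by
    rw [← Real.rpow_add hapos]
    have : 2 / r + 2 / p = 2 := by rw [hp]; field_simp; ring
    rw [this]; norm_num
  rw [e1] at cs2
  have cs3 := le_of_mul_le_mul_right cs2 (by positivity)
  have cs4 := Real.rpow_le_rpow (by positivity) cs3 (by norm_num : (0 : ℝ) ≤ 1 / 2)
  rw [← Real.rpow_mul ha0, Real.mul_rpow (by positivity) hb0, ← Real.rpow_natCast (r - 1) k,
    ← Real.rpow_mul hr1.le] at cs4
  convert cs4 using 2
  · ring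
  · ring_nf

end
end MC

/-- **Moment comparison.** If `T ∈ M_{2^n}` has Fourier degree at most `k`, then for every
`r ≥ 2`, `‖T‖_r ≤ (r-1)^{k/2} ‖T‖₂`. -/
theorem moment_comparison {n : ℕ} (k : ℕ) (T : QM n)
    (hdeg : ∀ s : Fin n → Fin 4, k < (QM.supp s).card → QM.fc T s = 0)
    (r : ℝ) (hr : 2 ≤ r) :
    QM.snorm r T ≤ (r - 1) ^ ((k : ℝ) / 2) * QM.snorm 2 T := by
  rcases hr.eq_or_lt with h | h
  · subst h
    norm_num
  · exact MC.final T hdeg r h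
end
end
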